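/- arXiv:1105.6137 — 3 statements merged into one kernel-verified Lean document; each statement's English description precedes it below -/
import Mathlib

section
/- Let α, β ∈ [0,1/2] be irrational. Then Ψ_{α,β} has periodic points of arbitrarily large period: for every M ∈ ℕ there exist a point p ∈ Y×N and an integer n > M such that Ψ_{α,β}ⁿ(p) = p and Ψ_{α,β}ʲ(p) ≠ p for all integers j with 0 < j < n. -/
open scoped Classical

/-- The lattice `Λ ⊂ ℝ²` generated by `(1/2, 1/2)` and `(−1/2, 1/2)`. -/
noncomputable def Lam : AddSubgroup (ℝ × ℝ) :=
  AddSubgroup.closure {((1:ℝ)/2, (1:ℝ)/2), (-((1:ℝ)/2), (1:ℝ)/2)}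

/-- The torus `Y = ℝ²/Λ`. -/
noncomputable abbrev Y : Type := (ℝ × ℝ) ⧸ Lam

/-- `N = {(1,0), (−1,0), (0,1), (0,−1)} ⊂ ℤ²`. -/
def Nset : Set (ℤ × ℤ) := {(1, 0), (-1, 0), (0, 1), (0, -1)}

/-- The canonical representative of a point of `ℝ²` in the fundamental domain
`[0,1/2) × [0,1)` of `Λ`: subtract `(⌊2x⌋/2, 0)` (if `⌊2x⌋` is even) or
`(⌊2x⌋/2, 1/2)` (if `⌊2x⌋` is odd), then reduce the second coordinate mod `ℤ`. -/
noncomputable def fundRep (p : ℝ × ℝ) : ℝ × ℝ :=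
  if Even ⌊2 * p.1⌋ then (p.1 - (⌊2 * p.1⌋ : ℝ) / 2, Int.fract p.2)
  else (p.1 - (⌊2 * p.1⌋ : ℝ) / 2, Int.fract (p.2 - 1/2))

/-- The sign `s ∈ {1,−1}` attached to a point of `Y`: `s = 1` if the representative of the
point in the fundamental domain `[0,1/2) × [0,1)` lies in `A₁ = [0,1/2) × [0,1/2)`, and
`s = −1` if it lies in `A₋₁ = [0,1/2) × [1/2,1)`. -/
noncomputable def sgn (q : Y) : ℤ :=
  if (fundRep q.out).2 < 1/2 then 1 else -1

/-- The rectangle exchange map `Ψ_{α,β}` on `Y × N`: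
`Ψ((x,y),(a,b)) = ((x + b·s·α, y + a·s·β) mod Λ, (b·s, a·s))`. -/
noncomputable def Psi (α β : ℝ) (p : Y × (ℤ × ℤ)) : Y × (ℤ × ℤ) :=
  (p.1 + (QuotientAddGroup.mk (((p.2.2 * sgn p.1 : ℤ) : ℝ) * α,
      ((p.2.1 * sgn p.1 : ℤ) : ℝ) * β) : Y),
    (p.2.2 * sgn p.1, p.2.1 * sgn p.1))

/-! ### Unbounded walks with recurrent `±1` increments -/

/-- The partial sums of a sequence of signs whose prefixes recur at odd times, and whose negated
prefixes occur arbitrarily late. -/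
structure RecurrentWalk (X w : ℕ → ℤ) : Prop where
  step : ∀ n, X (n + 1) = X n + w n
  sign : ∀ n, w n = 1 ∨ w n = -1
  recur : ∀ L, ∃ d, Odd d ∧ ∀ t < L, w (t + d) = w t
  antirecur : ∀ L, ∃ d, L ≤ d ∧ ∀ t < L, w (t + d) = -w t

theorem sub_eq_mul_sub_of_increments {X w : ℕ → ℤ} (hX : ∀ n, X (n + 1) = X n + w n)
    {c : ℤ} {L d : ℕ} (h : ∀ t < L, w (t + d) = c * w t) {t : ℕ} (ht : t ≤ L) :
    X (t + d) - X d = c * (X t - X 0) := by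
  induction t with
  | zero => simp
  | succ t ih =>
    have h1 := h t (by omega)
    have h2 := hX (t + d)
    have h3 := ih (by omega)
    rw [show t + 1 + d = t + d + 1 by ring, h2, hX t, h1]
    linear_combination h3

namespace RecurrentWalk

variable {X w : ℕ → ℤ}

theorem neg (h : RecurrentWalk X w) : RecurrentWalk (fun n => -X n) (fun n => -w n) where
  step n := by rw [h.step]; ring
  sign n := by rcases h.sign n with h | h <;> simp [h]
  recur L := by
    obtain ⟨d, hd, h⟩ := h.recur L
    exact ⟨d, hd, fun t ht => by rw [h t ht]⟩
  antirecur L := by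
    obtain ⟨d, hd, h⟩ := h.antirecur L
    exact ⟨d, hd, fun t ht => by rw [h t ht]⟩

theorem parity (h : RecurrentWalk X w) (p d : ℕ) : (2 : ℤ) ∣ X (p + d) - X p - d := by
  induction d with
  | zero => simp
  | succ d ih =>
    have h1 := h.step (p + d)
    rw [← add_assoc, h1]
    rcases h.sign (p + d) with h2 | h2 <;> rw [h2] <;> push_cast <;> omega

theorem exists_neg_translate (h : RecurrentWalk X w) (L : ℕ) :
    ∃ d, L ≤ d ∧ ∀ i ≤ L, ∀ j ≤ L, X (j + d) - X (i + d) = -(X j - X i) := by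
  obtain ⟨d, hd, hw⟩ := h.antirecur L
  refine ⟨d, hd, fun i hi j hj => ?_⟩
  have hw' : ∀ t < L, w (t + d) = -1 * w t := fun t ht => by rw [hw t ht]; ring
  have h1 := sub_eq_mul_sub_of_increments h.step hw' hi
  have h2 := sub_eq_mul_sub_of_increments h.step hw' hj
  linarith

theorem exists_le_sub (h : RecurrentWalk X w) (k : ℤ) : ∃ i j, i ≤ j ∧ k ≤ X j - X i := by
  by_contra! hb
  have hb' : ∀ i j, i ≤ j → -k < X j - X i := by
    intro i j hij
    obtain ⟨d, -, hd⟩ := h.exists_neg_translate j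
    have h1 := hd i hij j le_rfl
    have h2 := hb (i + d) (j + d) (by omega)
    linarith
  obtain ⟨D, ⟨i, j, hij, hD⟩, hmax⟩ := Int.exists_greatest_of_bdd
    (P := fun z => ∃ i j, i ≤ j ∧ X j - X i = z)
    ⟨k, fun z ⟨i, j, hij, hz⟩ => hz ▸ (hb i j hij).le⟩ ⟨_, 0, 0, le_rfl, rfl⟩
  obtain ⟨L, rfl⟩ := Nat.exists_eq_add_of_le hij
  have key : ∀ r : ℕ, ∃ p, i ≤ p ∧ X (p + L) - X p = D ∧ X p ≤ X i - r := by
    intro r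
    induction r with
    | zero => exact ⟨i, le_rfl, hD, by simp⟩
    | succ r ih =>
      obtain ⟨p, hip, hpD, hpr⟩ := ih
      obtain ⟨d, hd, hw⟩ := h.recur (p + L)
      have hw' : ∀ t < p + L, w (t + d) = 1 * w t := fun t ht => by rw [hw t ht]; ring
      have h1 := sub_eq_mul_sub_of_increments h.step hw' (show p ≤ p + L by omega)
      have h2 := sub_eq_mul_sub_of_increments h.step hw' le_rfl
      have h3 := hmax _ ⟨p, p + L + d, by omega, rfl⟩
      have h4 := h.parity p d
      obtain ⟨e, he⟩ := hd
      refine ⟨p + d, by omega, ?_, ?_⟩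
      · rw [show p + d + L = p + L + d by ring]; linarith
      · push_cast
        omega
  obtain ⟨p, hip, -, hp⟩ := key k.toNat
  have h1 := hb' i p hip
  have h2 := hb i i le_rfl
  omega

theorem exists_hill (h : RecurrentWalk X w) (k : ℤ) :
    ∃ i m j, i ≤ m ∧ m ≤ j ∧ (∀ t, i ≤ t → t ≤ j → X t ≤ X m) ∧
      X i ≤ X m - k ∧ X j ≤ X m - k := by
  obtain ⟨i, j, hij, hk⟩ := h.exists_le_sub k
  obtain ⟨d, hjd, hd⟩ := h.exists_neg_translate j
  obtain ⟨m, hm, hmax⟩ := Finset.exists_max_image (Finset.Icc i (j + d)) X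
    ⟨i, Finset.mem_Icc.2 ⟨le_rfl, by omega⟩⟩
  simp only [Finset.mem_Icc] at hm hmax
  have h1 := hd i hij j le_rfl
  have h2 := hmax j ⟨hij, by omega⟩
  have h3 := hmax (i + d) ⟨by omega, by omega⟩
  exact ⟨i, m, j + d, hm.1, hm.2, fun t h1 h2 => hmax t ⟨h1, h2⟩, by linarith, by linarith⟩

theorem sub_le (h : RecurrentWalk X w) (p d : ℕ) : X p - X (p + d) ≤ d := by
  induction d with
  | zero => simp
  | succ d ih =>
    rw [← add_assoc, h.step]
    rcases h.sign (p + d) with h2 | h2 <;> rw [h2] <;> push_cast <;> omega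

theorem exists_excursion (h : RecurrentWalk X w) (k : ℕ) (hk : 0 < k) :
    ∃ a b, a + k ≤ b ∧ X a = X b ∧ (∀ t, a < t → t < b → X a < X t) ∧
      ∀ t, a ≤ t → t ≤ b → X t ≤ X a + k := by
  obtain ⟨i, m, j, him, hmj, hmax, hi, hj⟩ := h.exists_hill k
  obtain ⟨a, ha, ha'⟩ := Finset.exists_max_image
    ((Finset.Icc i m).filter fun t => X t ≤ X m - k) id
    ⟨i, by simp [him, hi]⟩
  obtain ⟨b, hb, hb'⟩ := Finset.exists_min_image
    ((Finset.Icc m j).filter fun t => X t ≤ X m - k) id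
    ⟨j, by simp [hmj, hj]⟩
  simp only [Finset.mem_filter, Finset.mem_Icc, id, and_imp] at ha ha' hb hb'
  obtain ⟨⟨hia, ham⟩, hXa⟩ := ha
  obtain ⟨⟨hmb, hbj⟩, hXb⟩ := hb
  have ham' : a ≠ m := by rintro rfl; omega
  have hmb' : m ≠ b := by rintro rfl; omega
  have ea : X a = X m - k := by
    have h1 := h.step a
    have h2 := ha' (a + 1) (by omega) (by omega)
    rcases h.sign a with h3 | h3 <;> omega
  have eb : X b = X m - k := by
    obtain ⟨b, rfl⟩ : ∃ c, b = c + 1 := ⟨b - 1, by omega⟩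
    have h1 := h.step b
    have h2 := hb' b (by omega) (by omega)
    rcases h.sign b with h3 | h3 <;> omega
  refine ⟨a, b, ?_, by omega, fun t h1 h2 => ?_, fun t h1 h2 => ?_⟩
  · have h1 := h.sub_le m (b - m)
    rw [show m + (b - m) = b by omega] at h1
    omega
  · by_contra hlt
    rcases le_total t m with h3 | h3
    · have := ha' t (by omega) h3 (by omega)
      omega
    · have := hb' t h3 (by omega) (by omega)
      omega
  · have := hmax t (by omega) (by omega)
    omega

end RecurrentWalk

/-! ### Rotations by an irrational number -/

theorem Irrational.exists_odd_mul_mem_Ioo {α : ℝ} (hα : Irrational α) (θ : ℝ) {ε : ℝ}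
    (hε : 0 < ε) (N : ℕ) :
    ∃ d : ℕ, N ≤ d ∧ Odd d ∧ ∃ z : ℤ, ∃ δ : ℝ, 0 < δ ∧ δ < ε ∧ (d : ℝ) * α = θ + z + δ := by
  have hdense : DenseRange (fun n : ℕ => n • ((2 * α : ℝ) : AddCircle (1 : ℝ))) := by
    rw [← denseRange_zsmul_iff_nsmul, AddCircle.denseRange_zsmul_coe_iff, div_one]
    exact_mod_cast hα.natCast_mul two_ne_zero
  let c : ℝ := θ - (2 * N + 1) * α
  have hopen : IsOpen ((QuotientAddGroup.mk : ℝ → AddCircle (1 : ℝ)) '' Set.Ioo c (c + ε)) :=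
    QuotientAddGroup.isOpenMap_coe _ isOpen_Ioo
  obtain ⟨n, u, ⟨hu1, hu2⟩, hu⟩ := hdense.exists_mem_open hopen
    ((Set.nonempty_Ioo.2 (by linarith)).image _)
  have hu' : ((n * (2 * α) - u : ℝ) : AddCircle (1 : ℝ)) = 0 := by
    have : (u : AddCircle (1 : ℝ)) = n • ((2 * α : ℝ) : AddCircle (1 : ℝ)) := hu
    rw [AddCircle.coe_sub, this, ← AddCircle.coe_nsmul, nsmul_eq_mul, sub_self]
  obtain ⟨z, hz⟩ := (AddCircle.coe_eq_zero_iff (1 : ℝ)).1 hu'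
  rw [zsmul_eq_mul, mul_one] at hz
  refine ⟨2 * (N + n) + 1, by omega, ⟨N + n, rfl⟩, z, u - c, by linarith, by linarith, ?_⟩
  push_cast
  simp only [c]
  linarith

/-- The `1`-periodic square wave: `1` on `[0,1/2)` and `-1` on `[1/2,1)`. -/
noncomputable def squareWave (x : ℝ) : ℤ := if Even ⌊2 * x⌋ then 1 else -1

theorem squareWave_eq (x : ℝ) : squareWave x = 1 ∨ squareWave x = -1 := by
  unfold squareWave
  split_ifs <;> simp

theorem squareWave_add_int (x : ℝ) (z : ℤ) : squareWave (x + z) = squareWave x := by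
  have : ⌊2 * (x + z)⌋ = ⌊2 * x⌋ + 2 * z := by
    rw [← Int.floor_add_intCast]
    push_cast
    ring_nf
  simp [squareWave, this, Int.even_add]

theorem squareWave_add_half (x : ℝ) : squareWave (x + 1 / 2) = -squareWave x := by
  have : ⌊2 * (x + 1 / 2)⌋ = ⌊2 * x⌋ + 1 := by
    rw [← Int.floor_add_one]
    ring_nf
  simp only [squareWave, this, Int.even_add_one]
  split_ifs <;> simp

theorem squareWave_eq_one_iff (x : ℝ) : squareWave x = 1 ↔ Int.fract x < 1 / 2 := by
  have h0 := Int.fract_nonneg x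
  have h1 := Int.fract_lt_one x
  have hx : x = Int.fract x + ⌊x⌋ := (Int.fract_add_floor x).symm
  have hs : squareWave x = squareWave (Int.fract x) := by
    rw [← squareWave_add_int (Int.fract x) ⌊x⌋, ← hx]
  rw [hs, squareWave]
  by_cases h : Int.fract x < 1 / 2
  · have : ⌊2 * Int.fract x⌋ = 0 := by
      rw [Int.floor_eq_iff]; constructor <;> push_cast <;> linarith
    simp only [this, h, Even.zero, if_true]
  · have : ⌊2 * Int.fract x⌋ = 1 := by
      rw [Int.floor_eq_iff]; constructor <;> push_cast <;> linarith
    simp only [this, h, Int.not_even_one, if_false, iff_false]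
    decide

theorem exists_squareWave_add_eq (x : ℝ) :
    ∃ ε : ℝ, 0 < ε ∧ ∀ δ, 0 < δ → δ < ε → squareWave (x + δ) = squareWave x := by
  have h1 := Int.lt_floor_add_one (2 * x)
  have h2 := Int.floor_le (2 * x)
  refine ⟨(⌊2 * x⌋ + 1 - 2 * x) / 2, by linarith, fun δ h3 h4 => ?_⟩
  have : ⌊2 * (x + δ)⌋ = ⌊2 * x⌋ := by
    rw [Int.floor_eq_iff]; constructor <;> linarith
  simp [squareWave, this]

theorem exists_forall_squareWave_add_eq (x : ℕ → ℝ) (L : ℕ) :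
    ∃ ε : ℝ, 0 < ε ∧ ∀ t < L, ∀ δ, 0 < δ → δ < ε → squareWave (x t + δ) = squareWave (x t) := by
  induction L with
  | zero => exact ⟨1, one_pos, by simp⟩
  | succ L ih =>
    obtain ⟨ε, hε, h⟩ := ih
    obtain ⟨ε', hε', h'⟩ := exists_squareWave_add_eq (x L)
    refine ⟨min ε ε', lt_min hε hε', fun t ht δ h1 h2 => ?_⟩
    rcases Nat.lt_succ_iff_lt_or_eq.1 ht with ht | rfl
    · exact h t ht δ h1 (h2.trans_le (min_le_left _ _))
    · exact h' δ h1 (h2.trans_le (min_le_right _ _))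

theorem Irrational.recurrentWalk {α : ℝ} (hα : Irrational α) :
    RecurrentWalk (fun n => ∑ i ∈ Finset.range n, squareWave (i * α))
      (fun n => squareWave (n * α)) where
  step n := Finset.sum_range_succ _ n
  sign n := squareWave_eq _
  recur L := by
    obtain ⟨ε, hε, h⟩ := exists_forall_squareWave_add_eq (fun n => n * α) L
    obtain ⟨d, -, hd, z, δ, h1, h2, h3⟩ := hα.exists_odd_mul_mem_Ioo 0 hε 0
    refine ⟨d, hd, fun t ht => ?_⟩
    rw [← h t ht δ h1 h2, ← squareWave_add_int (_ + δ) z]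
    congr 1
    push_cast
    linarith
  antirecur L := by
    obtain ⟨ε, hε, h⟩ := exists_forall_squareWave_add_eq (fun n => n * α) L
    obtain ⟨d, hd, -, z, δ, h1, h2, h3⟩ := hα.exists_odd_mul_mem_Ioo (1 / 2) hε L
    refine ⟨d, hd, fun t ht => ?_⟩
    rw [← h t ht δ h1 h2, ← squareWave_add_half, ← squareWave_add_int (_ + 1 / 2) z]
    congr 1
    push_cast
    linarith

/-! ### Closed curves of oriented line systems -/

/-- Two consecutive moves along lines of `ℤ²`: a vertical one in the direction `ω m` of the
column `m` and a horizontal one in the direction `η n'` of the row `n'` just reached. -/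
def cornerStep (ω η : ℤ → ℤ) (p : ℤ × ℤ) : ℤ × ℤ :=
  (p.1 + η (p.2 + ω p.1), p.2 + ω p.1)

theorem cornerStep_injective (ω η : ℤ → ℤ) : Function.Injective (cornerStep ω η) := by
  rintro ⟨m, n⟩ ⟨m', n'⟩ h
  simp only [cornerStep, Prod.mk.injEq] at h ⊢
  obtain ⟨h1, h2⟩ := h
  rw [h2] at h1
  obtain rfl : m = m' := by omega
  exact ⟨rfl, by omega⟩

theorem Function.Injective.mem_periodicPts_of_mapsTo {S : Type*} {f : S → S}
    (hf : Function.Injective f) {s : Set S} (hs : s.Finite) (h : Set.MapsTo f s s) {x : S}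
    (hx : x ∈ s) : x ∈ Function.periodicPts f := by
  obtain ⟨i, -, j, -, hij, he⟩ := Set.infinite_univ.exists_ne_map_eq_of_mapsTo
    (f := fun n : ℕ => f^[n] x) (fun n _ => h.iterate n hx) hs
  rcases hij.lt_or_gt with hlt | hlt
  · exact ⟨j - i, by omega, Function.iterate_cancel hf he.symm⟩
  · exact ⟨i - j, by omega, Function.iterate_cancel hf he⟩

/-- Along each closed curve the orientations of the lines and their partial sums `X`, `Y` satisfy
this conservation law. -/
def cornerHeight (ω η X Y : ℤ → ℤ) (p : ℤ × ℤ) : ℤ :=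
  2 * Y p.2 - 2 * X p.1 + η p.2 - ω p.1 + ω p.1 * η p.2

theorem exists_long_cornerStep_cycle {ω η X Y : ℤ → ℤ} {a b n₀ n₁ n₂ h : ℤ}
    (hω : ∀ m, ω m = 1 ∨ ω m = -1) (hη : ∀ n, η n = 1 ∨ η n = -1)
    (hX : ∀ m, a ≤ m → m < b → X (m + 1) = X m + ω m)
    (hY : ∀ n, n₁ ≤ n → n < n₂ → Y (n + 1) = Y n + η n)
    (hab : a + 1 < b) (hXab : X a = X b) (hXlt : ∀ m, a < m → m < b → X a < X m)
    (hXle : ∀ m, a ≤ m → m ≤ b → X m ≤ X a + h)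
    (hn₁ : n₁ ≤ n₀) (hn₂ : n₀ ≤ n₂) (hYmin : ∀ n, n₁ ≤ n → n ≤ n₂ → Y n₀ ≤ Y n)
    (hY₁ : Y n₀ + h + 2 ≤ Y n₁) (hY₂ : Y n₀ + h + 2 ≤ Y n₂) :
    (b - 1, n₀) ∈ Function.periodicPts (cornerStep ω η) ∧
      ∀ t : ℕ, 0 < t → (cornerStep ω η)^[t] (b - 1, n₀) = (b - 1, n₀) → b - 1 - a ≤ t := by
  have hX' : ∀ m, a < m → m ≤ b → X m = X (m - 1) + ω (m - 1) := fun m h1 h2 => by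
    have := hX (m - 1) (by omega) (by omega)
    rwa [sub_add_cancel] at this
  have hY' : ∀ n, n₁ < n → n ≤ n₂ → Y n = Y (n - 1) + η (n - 1) := fun n h1 h2 => by
    have := hY (n - 1) (by omega) (by omega)
    rwa [sub_add_cancel] at this
  have hh : 0 ≤ h := by
    have := hXle a le_rfl (by omega)
    omega
  have hn₁' : n₁ ≠ n₀ := by rintro rfl; omega
  have hn₂' : n₀ ≠ n₂ := by rintro rfl; omega
  have hωa : ω a = 1 := by
    have h1 := hX a le_rfl (by omega)
    have h2 := hXlt (a + 1) (by omega) hab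
    rcases hω a with h3 | h3 <;> omega
  have hωb : ω (b - 1) = -1 ∧ X (b - 1) = X a + 1 := by
    have h1 := hX' b (by omega) le_rfl
    have h2 := hXlt (b - 1) (by omega) (by omega)
    rcases hω (b - 1) with h3 | h3 <;> omega
  have hηn₀ : η n₀ = 1 := by
    have h1 := hY n₀ hn₁ (by omega)
    have h2 := hYmin (n₀ + 1) (by omega) (by omega)
    rcases hη n₀ with h3 | h3 <;> omega
  let s : Set (ℤ × ℤ) := {p | a ≤ p.1 ∧ p.1 < b ∧ n₁ < p.2 ∧ p.2 < n₂ ∧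
    cornerHeight ω η X Y p = 2 * (Y n₀ - X a) - 1}
  have hsfin : s.Finite := ((Set.finite_Icc a b).prod (Set.finite_Icc n₁ n₂)).subset
    fun p ⟨h1, h2, h3, h4, _⟩ => ⟨⟨h1, h2.le⟩, h3.le, h4.le⟩
  have hstart : (b - 1, n₀) ∈ s := by
    refine ⟨by dsimp only; omega, by dsimp only; omega, by dsimp only; omega,
      by dsimp only; omega, ?_⟩
    simp only [cornerHeight, hωb.1, hωb.2, hηn₀]
    ring
  have hmaps : Set.MapsTo (cornerStep ω η) s s := by
    rintro ⟨m, n⟩ ⟨h1, h2, h3, h4, h5⟩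
    simp only [cornerHeight] at h1 h2 h3 h4 h5
    suffices H : a ≤ m + η (n + ω m) ∧ m + η (n + ω m) < b ∧
        cornerHeight ω η X Y (m + η (n + ω m), n + ω m) = 2 * (Y n₀ - X a) - 1 by
      obtain ⟨h6, h7, h8⟩ := H
      refine ⟨h6, h7, ?_, ?_, h8⟩
      all_goals
        simp only [cornerStep, cornerHeight] at h8 ⊢
        generalize m + η (n + ω m) = m' at *
        have h9 := hXle m' h6 h7.le
        have h10 : n + ω m ≤ n₂ ∧ n₁ ≤ n + ω m := by rcases hω m with h | h <;> omega
        generalize n + ω m = n' at *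
        refine lt_of_le_of_ne (by omega) ?_
        rintro rfl
        rcases hω m' with e1 | e1 <;> rcases hη _ with e2 | e2 <;>
          rw [e1, e2] at h8 <;> omega
    have key : m = b - 1 → η (n + ω m) = -1 := by
      rintro rfl
      rw [hωb.1, hωb.2] at h5
      rw [hωb.1, ← sub_eq_add_neg]
      have e1 := hY' n h3 h4.le
      have e2 := hYmin (n - 1) (by omega) (by omega)
      rcases hη (n - 1) with e3 | e3 <;> omega
    have key' : m = a → η (n + ω m) = 1 := by
      rintro rfl
      rw [hωa] at h5 ⊢
      have e1 := hY n h3.le h4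
      have e4 : n + 1 ≠ n₂ := by rintro rfl; omega
      have e2 := hY (n + 1) (by omega) (by omega)
      have e3 := hYmin (n + 1 + 1) (by omega) (by omega)
      rcases hη (n + 1) with e5 | e5 <;> omega
    refine ⟨?_, ?_, ?_⟩
    · rcases hη (n + ω m) with e | e <;> rw [e] at key' ⊢ <;> omega
    · rcases hη (n + ω m) with e | e <;> rw [e] at key ⊢ <;> omega
    · have hYn : Y (n + ω m) + Y (n + ω m) + η (n + ω m) - ω m * η (n + ω m) =
          Y n + Y n + η n + ω m * η n := by
        rcases hω m with e | e <;> rw [e]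
        · linarith [hY n h3.le h4]
        · rw [← sub_eq_add_neg]
          linarith [hY' n h3 h4.le]
      simp only [cornerHeight]
      generalize n + ω m = n' at *
      rcases hη n' with e | e <;> rw [e] at hYn key key' ⊢
      · have e1 := hX m h1 h2
        linarith
      · have hma : m ≠ a := fun hm => absurd (key' hm) (by decide)
        have e1 := hX' m (by omega) h2.le
        rw [← sub_eq_add_neg m]
        linarith
  refine ⟨(cornerStep_injective ω η).mem_periodicPts_of_mapsTo hsfin hmaps hstart, ?_⟩
  intro t ht hper
  have hmem : ∀ i, (cornerStep ω η)^[i] (b - 1, n₀) ∈ s := fun i => hmaps.iterate i hstart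
  set q : ℕ → ℤ × ℤ := fun i => (cornerStep ω η)^[i] (b - 1, n₀) with hq
  have hsucc : ∀ i, q (i + 1) = cornerStep ω η (q i) := fun i =>
    Function.iterate_succ_apply' _ _ _
  have hdist : ∀ i : ℕ, b - 1 - (q i).1 ≤ i := by
    intro i
    induction i with
    | zero => simp [hq]
    | succ i ih =>
      rw [hsucc, cornerStep]
      push_cast
      rcases hη ((q i).2 + ω (q i).1) with e | e <;> rw [e] <;> omega
  obtain ⟨i, hit, hi1, hi2⟩ : ∃ i < t, (q i).2 = n₀ - 1 ∧ (q (i + 1)).2 = n₀ := by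
    by_contra! hcon
    have hlow : ∀ i, i < t → (q (i + 1)).2 < n₀ := by
      intro i hi
      induction i with
      | zero =>
        rw [hsucc]
        simp [cornerStep, hq, hωb.1]
      | succ i ih =>
        have e1 := ih (by omega)
        have e2 := hcon (i + 1) hi
        have e3 : (q (i + 1 + 1)).2 = (q (i + 1)).2 + ω (q (i + 1)).1 := by
          rw [hsucc (i + 1), cornerStep]
        rcases hω (q (i + 1)).1 with e | e <;> omega
    have := hlow (t - 1) (by omega)
    rw [Nat.sub_add_cancel ht] at this
    exact absurd (congrArg Prod.snd hper) this.ne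
  obtain ⟨h1, h2, h3, h4, h5⟩ := hmem i
  have e1 : (q (i + 1)).2 = (q i).2 + ω (q i).1 := by rw [hsucc, cornerStep]
  have e2 := hY' n₀ (by omega) hn₂
  have e3 : ω (q i).1 = 1 := by omega
  have e4 : X (q i).1 = X a := by
    change cornerHeight ω η X Y (q i) = _ at h5
    rw [cornerHeight, e3, hi1] at h5
    omega
  have e5 : (q i).1 = a := by
    by_contra hne
    have := hXlt (q i).1 (lt_of_le_of_ne h1 (Ne.symm hne)) h2
    omega
  have := hdist i
  omega

/-! ### The rectangle exchange map -/

theorem exists_int_of_mem_Lam {v : ℝ × ℝ} (hv : v ∈ Lam) :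
    ∃ p q : ℤ, v = ((p / 2 + q : ℝ), (p / 2 : ℝ)) := by
  induction hv using AddSubgroup.closure_induction with
  | mem x hx =>
    rcases hx with rfl | rfl
    · exact ⟨1, 0, by norm_num⟩
    · exact ⟨1, -1, by norm_num⟩
  | zero => exact ⟨0, 0, by ext <;> simp⟩
  | add x y _ _ hx hy =>
    obtain ⟨p, q, rfl⟩ := hx
    obtain ⟨p', q', rfl⟩ := hy
    exact ⟨p + p', q + q', by ext <;> push_cast <;> simp <;> ring⟩
  | neg x _ hx =>
    obtain ⟨p, q, rfl⟩ := hx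
    exact ⟨-p, -q, by ext <;> push_cast <;> simp <;> ring⟩

theorem squareWave_add_int_div_two (x y : ℝ) (p : ℤ) :
    squareWave (x + p / 2) * squareWave (y + p / 2) = squareWave x * squareWave y := by
  rcases Int.even_or_odd' p with ⟨c, rfl | rfl⟩
  · have : ((2 * c : ℤ) : ℝ) / 2 = c := by push_cast; ring
    rw [this, squareWave_add_int, squareWave_add_int]
  · have : ((2 * c + 1 : ℤ) : ℝ) / 2 = 1 / 2 + c := by push_cast; ring
    rw [this, ← add_assoc, ← add_assoc, squareWave_add_int, squareWave_add_int,
      squareWave_add_half, squareWave_add_half, neg_mul_neg]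

theorem ite_fundRep_snd_eq (v : ℝ × ℝ) :
    (if (fundRep v).2 < 1 / 2 then 1 else -1 : ℤ) = squareWave v.1 * squareWave v.2 := by
  have key : ∀ y : ℝ, (if Int.fract y < 1 / 2 then 1 else -1 : ℤ) = squareWave y := by
    intro y
    rcases squareWave_eq y with h | h
    · rw [if_pos ((squareWave_eq_one_iff y).1 h), h]
    · rw [if_neg, h]
      rw [← squareWave_eq_one_iff, h]
      decide
  unfold fundRep
  by_cases h : Even ⌊2 * v.1⌋
  · rw [if_pos h, key, squareWave.eq_1 v.1, if_pos h, one_mul]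
  · rw [if_neg h, key, squareWave.eq_1 v.1, if_neg h, ← sub_add_cancel v.2 (1 / 2),
      squareWave_add_half, sub_add_cancel]
    ring

theorem sgn_mk (v : ℝ × ℝ) :
    sgn (QuotientAddGroup.mk v) = squareWave v.1 * squareWave v.2 := by
  have hmem : -v + (QuotientAddGroup.mk v : Y).out ∈ Lam := by
    rw [← QuotientAddGroup.eq]
    exact (QuotientAddGroup.out_eq' _).symm
  obtain ⟨p, q, h⟩ := exists_int_of_mem_Lam hmem
  have h' : (QuotientAddGroup.mk v : Y).out = v + ((p / 2 + q : ℝ), (p / 2 : ℝ)) := by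
    rw [← h, add_neg_cancel_left]
  rw [sgn, ite_fundRep_snd_eq, h', Prod.fst_add, Prod.snd_add, ← add_assoc, squareWave_add_int,
    squareWave_add_int_div_two]

/-- The point of `Y × N` that arrives horizontally at the vertex `(m, n)` of the curve system
with column orientations `squareWave (m * α)` and row orientations `squareWave (n * β)`. -/
noncomputable def latticePoint (α β : ℝ) (p : ℤ × ℤ) : Y × (ℤ × ℤ) :=
  (QuotientAddGroup.mk (p.1 * α, p.2 * β), (squareWave (p.2 * β), 0))

theorem latticePoint_injective {α β : ℝ} (hα : Irrational α) (hβ : Irrational β) :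
    Function.Injective (latticePoint α β) := by
  have key : ∀ {γ : ℝ}, Irrational γ → ∀ {i j p q : ℤ}, -(i * γ) + j * γ = p / 2 + q → i = j := by
    intro γ hγ i j p q h
    by_contra hne
    have hne' : 2 * (j - i) ≠ 0 := by omega
    apply (hγ.intCast_mul hne').ne_int (p + 2 * q)
    push_cast
    linarith
  rintro ⟨m, n⟩ ⟨m', n'⟩ h
  have h1 : (QuotientAddGroup.mk ((m : ℝ) * α, (n : ℝ) * β) : Y) =
    QuotientAddGroup.mk ((m' : ℝ) * α, (n' : ℝ) * β) := congrArg Prod.fst h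
  obtain ⟨p, q, h2⟩ := exists_int_of_mem_Lam (QuotientAddGroup.eq.1 h1)
  simp only [Prod.neg_mk, Prod.mk_add_mk, Prod.mk.injEq] at h2
  have h3 : -((n : ℝ) * β) + n' * β = p / 2 + (0 : ℤ) := by rw [h2.2]; simp
  rw [key hα h2.1, key hβ h3]

theorem Psi_Psi_latticePoint (α β : ℝ) (p : ℤ × ℤ) :
    Psi α β (Psi α β (latticePoint α β p)) = latticePoint α β
      (cornerStep (fun m => squareWave (m * α)) (fun n => squareWave (n * β)) p) := by
  obtain ⟨m, n⟩ := p
  have hsq : ∀ x, squareWave x * squareWave x = 1 := fun x => by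
    rcases squareWave_eq x with h | h <;> simp [h]
  have h1 : Psi α β (latticePoint α β (m, n)) =
      (QuotientAddGroup.mk (m * α, ((n + squareWave (m * α) : ℤ) : ℝ) * β),
        (0, squareWave (m * α))) := by
    have e : squareWave (n * β) * (squareWave (m * α) * squareWave (n * β)) =
        squareWave (m * α) := by
      linear_combination squareWave (m * α) * hsq (n * β)
    simp only [Psi, latticePoint, sgn_mk, e, zero_mul, ← QuotientAddGroup.mk_add, Prod.mk_add_mk]
    push_cast
    simp [add_mul]
  rw [h1]
  simp only [cornerStep]
  generalize n + squareWave (m * α) = n'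
  have e : squareWave (m * α) * (squareWave (m * α) * squareWave (n' * β)) =
      squareWave (n' * β) := by
    linear_combination squareWave (n' * β) * hsq (m * α)
  simp only [Psi, latticePoint, sgn_mk, e, zero_mul, ← QuotientAddGroup.mk_add, Prod.mk_add_mk]
  push_cast
  simp [add_mul]

theorem iterate_Psi_latticePoint (α β : ℝ) (p : ℤ × ℤ) (t : ℕ) :
    (Psi α β)^[2 * t] (latticePoint α β p) = latticePoint α β
      ((cornerStep (fun m => squareWave (m * α)) (fun n => squareWave (n * β)))^[t] p) := by
  rw [Function.iterate_mul]
  exact (Function.Semiconj.iterate_right (f := latticePoint α β)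
    (fun p => (Psi_Psi_latticePoint α β p).symm) t p).symm

/-- If `α, β ∈ [0,1/2]` are irrational, then `Ψ_{α,β}` has periodic points
of arbitrarily large (minimal) period. -/
theorem psi_has_arbitrarily_large_periods (α β : ℝ)
    (hα : α ∈ Set.Icc (0:ℝ) (1/2)) (hβ : β ∈ Set.Icc (0:ℝ) (1/2))
    (hαirr : Irrational α) (hβirr : Irrational β) :
    ∀ M : ℕ, ∃ (p : Y × (ℤ × ℤ)) (n : ℕ), p.2 ∈ Nset ∧ M < n ∧
      (Psi α β)^[n] p = p ∧ ∀ j : ℕ, 0 < j → j < n → (Psi α β)^[j] p ≠ p := by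
  intro M
  obtain ⟨a, b, hab, hXab, hXlt, hXle⟩ := hαirr.recurrentWalk.exists_excursion (M + 2) (by omega)
  obtain ⟨n₁, n₀, n₂, h₁, h₂, hmax, hY₁, hY₂⟩ :=
    hβirr.recurrentWalk.neg.exists_hill ((M + 2 : ℕ) + 2)
  have hstep : ∀ {γ : ℝ} (m : ℤ), 0 ≤ m →
      ∑ i ∈ Finset.range (m + 1).toNat, squareWave (i * γ) =
        ∑ i ∈ Finset.range m.toNat, squareWave (i * γ) + squareWave (m * γ) := by
    intro γ m hm
    lift m to ℕ using hm
    exact Finset.sum_range_succ _ m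
  obtain ⟨hper, hlong⟩ := exists_long_cornerStep_cycle
    (ω := fun m => squareWave (m * α)) (η := fun n => squareWave (n * β))
    (X := fun m => ∑ i ∈ Finset.range m.toNat, squareWave (i * α))
    (Y := fun n => ∑ i ∈ Finset.range n.toNat, squareWave (i * β))
    (a := a) (b := b) (n₀ := n₀) (n₁ := n₁) (n₂ := n₂) (h := (M + 2 : ℕ))
    (fun _ => squareWave_eq _) (fun _ => squareWave_eq _)
    (fun m h _ => hstep m (by omega)) (fun n h _ => hstep n (by omega))
    (by omega) hXab
    (fun m h h' => by
      lift m to ℕ using by omega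
      exact hXlt m (by omega) (by omega))
    (fun m h h' => by
      lift m to ℕ using by omega
      exact hXle m (by omega) (by omega))
    (by omega) (by omega)
    (fun n h h' => by
      lift n to ℕ using by omega
      exact neg_le_neg_iff.1 (hmax n (by omega) (by omega)))
    (by simp only [Int.toNat_natCast]; linarith) (by simp only [Int.toNat_natCast]; linarith)
  set p := latticePoint α β ((b : ℤ) - 1, (n₀ : ℤ)) with hp
  have hperΨ : p ∈ Function.periodicPts (Psi α β) := by
    obtain ⟨t, ht, hfix⟩ := hper
    refine ⟨2 * t, by omega, ?_⟩
    rw [Function.IsPeriodicPt, Function.IsFixedPt, hp, iterate_Psi_latticePoint, hfix.eq]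
  have hpos := Function.minimalPeriod_pos_of_mem_periodicPts hperΨ
  refine ⟨p, Function.minimalPeriod (Psi α β) p, ?_, ?_,
    Function.isPeriodicPt_minimalPeriod _ _, fun j h h' =>
      Function.not_isPeriodicPt_of_pos_of_lt_minimalPeriod h.ne' h'⟩
  · rcases squareWave_eq ((n₀ : ℤ) * β) with h | h <;> simp only [hp, latticePoint, h, Nset] <;> simp
  · have hfix := (Function.isPeriodicPt_minimalPeriod (Psi α β) p).const_mul 2
    rw [Function.IsPeriodicPt, Function.IsFixedPt, hp, iterate_Psi_latticePoint] at hfix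
    have := hlong _ hpos (latticePoint_injective hαirr hβirr hfix)
    omega
end

section
/- The set of pairs (α,β) ∈ [0,1/2]×[0,1/2] with α and β irrational and M(α,β) ≠ 1 is dense in [0,1/2]×[0,1/2]. -/
open MeasureTheory
open scoped Classical ENNReal

/-- Normalized Lebesgue (Haar) measure on `Y`: the pushforward of twice Lebesgue measure
restricted to the fundamental domain `[0,1/2) × [0,1)`; it has total mass `1`. -/
noncomputable def mY : Measure Y :=
  Measure.map (QuotientAddGroup.mk : ℝ × ℝ → Y)
    ((2 : ℝ≥0∞) • volume.restrict (Set.Ico (0:ℝ) (1/2) ×ˢ Set.Ico (0:ℝ) 1))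

/-- The uniform probability measure on `N`, assigning mass `1/4` to each of the four
elements of `N`. -/
noncomputable def mN : Measure (ℤ × ℤ) :=
  (4 : ℝ≥0∞)⁻¹ • (Measure.dirac ((1:ℤ), (0:ℤ)) + Measure.dirac ((-1:ℤ), (0:ℤ)) +
    Measure.dirac ((0:ℤ), (1:ℤ)) + Measure.dirac ((0:ℤ), (-1:ℤ)))

/-- The measure `λ` on `Y × N`, normalized so that `λ(Y × N) = 1`. -/
noncomputable def lamMeas : Measure (Y × (ℤ × ℤ)) := mY.prod mN

/-- `M(α,β)`: the `λ`-measure of the set of periodic points of `Ψ_{α,β}`. -/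
noncomputable def Mab (α β : ℝ) : ℝ≥0∞ :=
  lamMeas {p : Y × (ℤ × ℤ) | ∃ n : ℕ, 1 ≤ n ∧ (Psi α β)^[n] p = p}

/-- `1` on `[0, 1/2)` and `-1` on `[1/2, 1)`, extended with period `1`. -/
noncomputable def halfSign (x : ℝ) : ℤ := if Int.fract x < 1 / 2 then 1 else -1

/-- The first `N` steps of a lattice path which alternately moves horizontally, in the direction
`η` prescribed by the current row, and vertically, in the direction `ω` prescribed by the
current column. -/
def IsPath (ω η : ℤ → ℤ) (m n : ℕ → ℤ) (N : ℕ) : Prop :=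
  ∀ k < N, m (k + 1) = m k + η (n k) ∧ n (k + 1) = n k + ω (m (k + 1))

lemma halfSign_eq_or (x : ℝ) : halfSign x = 1 ∨ halfSign x = -1 := by
  unfold halfSign; split_ifs <;> simp

lemma halfSign_eq_ite_even (x : ℝ) : halfSign x = if Even ⌊2 * x⌋ then 1 else -1 := by
  have h1 := Int.floor_add_fract x
  have h0 := Int.fract_nonneg x
  have h2 := Int.fract_lt_one x
  unfold halfSign
  by_cases h : Int.fract x < 1 / 2
  · have : ⌊2 * x⌋ = 2 * ⌊x⌋ := by
      rw [Int.floor_eq_iff]; push_cast; constructor <;> linarith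
    rw [if_pos h, if_pos (by simp [this])]
  · have : ⌊2 * x⌋ = 2 * ⌊x⌋ + 1 := by
      rw [Int.floor_eq_iff]; push_cast; constructor <;> linarith
    rw [if_neg h, if_neg (by simp [this])]

lemma halfSign_add_int (x : ℝ) (k : ℤ) : halfSign (x + k) = halfSign x := by
  simp [halfSign]

lemma halfSign_add_half (x : ℝ) : halfSign (x + 1 / 2) = -halfSign x := by
  have : ⌊2 * (x + 1 / 2)⌋ = ⌊2 * x⌋ + 1 := by
    rw [← Int.floor_add_one]; ring_nf
  rw [halfSign_eq_ite_even, halfSign_eq_ite_even, this]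
  by_cases h : Even ⌊2 * x⌋
  · rw [if_pos h, if_neg (by simpa [Int.even_add_one] using h)]
  · rw [if_neg h, if_pos (by simpa [Int.even_add_one] using h), neg_neg]

lemma exists_crossing (u : ℕ → ℤ) (N : ℕ) (h : u 0 + 2 ≤ u N) :
    ∃ a b, a < b ∧ b ≤ N ∧ u a ≤ u 0 ∧ u 0 + 2 ≤ u b ∧ ∀ k, a < k → k < b → u k = u 0 + 1 := by
  classical
  have hex : ∃ b, u 0 + 2 ≤ u b := ⟨N, h⟩
  set b := Nat.find hex with hb
  have hb1 : u 0 + 2 ≤ u b := Nat.find_spec hex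
  have hbm : ∀ k < b, ¬ (u 0 + 2 ≤ u k) := fun k hk => Nat.find_min hex hk
  have hb0 : 0 < b := by
    rcases Nat.eq_zero_or_pos b with h0 | h0
    · rw [h0] at hb1; omega
    · exact h0
  let P : ℕ → Prop := fun k => k < b ∧ u k ≤ u 0
  have hP0 : P 0 := ⟨hb0, le_rfl⟩
  have hPs : P (Nat.findGreatest P b) := Nat.findGreatest_spec (Nat.zero_le b) hP0
  refine ⟨Nat.findGreatest P b, b, hPs.1, Nat.find_min' hex h, hPs.2, hb1, fun k hk1 hk2 => ?_⟩
  have h1 : ¬ P k := Nat.findGreatest_is_greatest hk1 hk2.le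
  have h2 := hbm k hk2
  simp only [P, not_and] at h1
  have h3 := h1 hk2
  omega

lemma abs_sub_le_of_block (u : ℕ → ℤ) (T : ℕ) (hT : 0 < T) (N : ℕ)
    (h : ∀ k t, t ≤ T → k + t ≤ N → |u (k + t) - u k| ≤ 1) :
    |(u N : ℝ) - u 0| ≤ N / T + 1 := by
  have key : ∀ i, i * T ≤ N → |u (i * T) - u 0| ≤ i := by
    intro i
    induction i with
    | zero => simp
    | succ i ih =>
      intro hi
      have h1 := ih (by nlinarith)
      have h2 := h (i * T) T le_rfl (by linarith)
      rw [show (i + 1) * T = i * T + T by ring]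
      push_cast
      rw [abs_le] at *
      constructor <;> linarith
  have h1 := key (N / T) (Nat.div_mul_le_self N T)
  have h2 := h (N / T * T) (N % T) (Nat.mod_lt _ hT).le (by rw [Nat.div_add_mod'])
  rw [Nat.div_add_mod'] at h2
  have h3 : |u N - u 0| ≤ ((N / T : ℕ) : ℤ) + 1 := by
    rw [abs_le] at *
    constructor <;> linarith
  have h4 : |(u N : ℝ) - u 0| ≤ ((N / T : ℕ) : ℝ) + 1 := by
    rw [← Int.cast_natCast]; exact_mod_cast h3
  have h5 : ((N / T : ℕ) : ℝ) ≤ N / T := Nat.cast_div_le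
  linarith

/-- If completely crossing one of the intervals `{i | ⌊X + i / L⌋ = J}` takes more than `T` steps,
then a sequence moves at speed at most `L / T`. -/
lemma abs_sub_le_of_crossing (z : ℕ → ℤ) (X L : ℝ) (hL : 0 < L) (T : ℕ) (hT : 0 < T) (N : ℕ)
    (hc : ∀ a b J, a < b → b ≤ N → L < |(z b : ℝ) - z a| →
      (∀ k, a < k → k < b → ⌊X + z k / L⌋ = J) → T < b - a) :
    |(z N : ℝ) - z 0| ≤ L * (N / T + 2) := by
  set u : ℕ → ℤ := fun k => ⌊X + z k / L⌋ with hu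
  have hfar : ∀ i j, u i + 2 ≤ u j → L < (z j : ℝ) - z i := by
    intro i j hij
    have h1 := Int.floor_le (X + z j / L)
    have h2 := Int.lt_floor_add_one (X + z i / L)
    have h3 : (u i : ℝ) + 2 ≤ u j := by exact_mod_cast hij
    have h4 : 1 < ((z j : ℝ) - z i) / L := by
      rw [sub_div]; simp only [hu] at h3; linarith
    rwa [lt_div_iff₀ hL, one_mul] at h4
  have hblock : ∀ k t, t ≤ T → k + t ≤ N → |u (k + t) - u k| ≤ 1 := by
    intro k t ht hk
    by_contra hcon
    have : u k + 2 ≤ u (k + t) ∨ -u k + 2 ≤ -u (k + t) := by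
      rcases le_total 0 (u (k + t) - u k) with h | h
      · rw [abs_of_nonneg h] at hcon; left; omega
      · rw [abs_of_nonpos h] at hcon; right; omega
    rcases this with h | h
    · obtain ⟨a, b, hab, hb, h1, h2, h3⟩ := exists_crossing (fun i => u (k + i)) t h
      simp only [add_zero] at h1 h2 h3
      have h4 := hfar (k + a) (k + b) (by omega)
      have := hc (k + a) (k + b) (u k + 1) (by omega) (by omega) (h4.trans_le (le_abs_self _))
        (fun i hi1 hi2 => by
          have := h3 (i - k) (by omega) (by omega)
          rwa [show k + (i - k) = i by omega] at this)
      omega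
    · obtain ⟨a, b, hab, hb, h1, h2, h3⟩ := exists_crossing (fun i => -u (k + i)) t h
      simp only [add_zero] at h1 h2 h3
      have h4 := hfar (k + b) (k + a) (by omega)
      have := hc (k + a) (k + b) (u k - 1) (by omega) (by omega)
        (h4.trans_le (by rw [abs_sub_comm]; exact le_abs_self _))
        (fun i hi1 hi2 => by
          have := h3 (i - k) (by omega) (by omega)
          rw [show k + (i - k) = i by omega] at this
          change u i = _
          omega)
      omega
  have h := abs_sub_le_of_block u T hT N hblock
  have h1 := Int.floor_le (X + z N / L)
  have h2 := Int.lt_floor_add_one (X + z N / L)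
  have h3 := Int.floor_le (X + z 0 / L)
  have h4 := Int.lt_floor_add_one (X + z 0 / L)
  have h5 : |((z N : ℝ) - z 0) / L| ≤ N / T + 2 := by
    rw [sub_div]
    simp only [hu] at h
    rw [abs_le] at h ⊢
    constructor <;> linarith
  rwa [abs_div, abs_of_pos hL, div_le_iff₀' hL] at h5

lemma exists_block_length {v v' : ℝ} (hv : 0 ≤ v) (hvv : v < v') (C : ℝ) (hC : 0 ≤ C) :
    ∃ L₀ : ℝ, 0 < L₀ ∧ ∀ L, L₀ ≤ L → ∃ T : ℕ, 0 < T ∧ L ≤ v' * T ∧ v * T + C < L := by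
  have hv' : 0 < v' := hv.trans_lt hvv
  refine ⟨(v + C + 1) * v' / (v' - v), by have := sub_pos.2 hvv; positivity, fun L hL => ?_⟩
  have hd := sub_pos.2 hvv
  have hL0 : 0 < L := lt_of_lt_of_le (by positivity) hL
  refine ⟨⌈L / v'⌉₊, Nat.ceil_pos.2 (by positivity), ?_, ?_⟩
  · have := Nat.le_ceil (L / v')
    rwa [div_le_iff₀' hv'] at this
  · have h1 := (Nat.ceil_lt_add_one (show 0 ≤ L / v' by positivity)).le
    have h2 : v * ⌈L / v'⌉₊ ≤ v * (L / v' + 1) := by gcongr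
    rw [div_le_iff₀ hd] at hL
    have h3 : v * (L / v' + 1) + C < L := by
      have : L - v * (L / v' + 1) - C = (L * (v' - v) - (v + C) * v') / v' := by field_simp; ring
      have : 0 < L - v * (L / v' + 1) - C := by
        rw [this]; apply div_pos _ hv'; nlinarith
      linarith
    linarith

lemma halfSign_congr {x y : ℝ} (h : ⌊2 * x⌋ = ⌊2 * y⌋) : halfSign x = halfSign y := by
  simp only [halfSign_eq_ite_even, h]

/-- On each interval of columns `⌊2 q x + i / L⌋ = J`, the sign sequence of the slope
`p / q + 1 / (2 q L)` coincides with a sign sequence of the slope `p / q`. -/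
lemma halfSign_perturb (p : ℤ) {q : ℕ} (hq : 0 < q) {L : ℝ} (hL : 0 < L) (x : ℝ) (i J : ℤ)
    (h : ⌊2 * q * x + i / L⌋ = J) :
    halfSign (x + i * (p / q + 1 / (2 * q * L))) = halfSign (J / (2 * q) + i * (p / q)) := by
  have hq' : (0 : ℝ) < q := by exact_mod_cast hq
  apply halfSign_congr
  have e1 : 2 * (x + i * (p / q + 1 / (2 * q * L))) =
      ((2 * q * x + i / L) + (2 * i * p : ℤ)) / (q : ℝ) := by
    push_cast; field_simp; ring
  have e2 : 2 * ((J : ℝ) / (2 * q) + i * (p / q)) = ((J + 2 * i * p : ℤ) : ℝ) / (q : ℝ) := by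
    push_cast; field_simp
  rw [e1, e2, Int.floor_div_natCast, Int.floor_div_natCast, Int.floor_add_intCast, h,
    Int.floor_intCast]

lemma exists_antidifference (f : ℤ → ℤ) : ∃ F : ℤ → ℤ, ∀ i, F i = F (i - 1) + f i := by
  refine ⟨fun i => ∑ j ∈ Finset.Ioc 0 i, f j - ∑ j ∈ Finset.Ioc i 0, f j, fun i => ?_⟩
  rcases le_or_gt i 0 with h | h
  · have h1 : Finset.Ioc (0 : ℤ) i = ∅ := Finset.Ioc_eq_empty (by omega)
    have h2 : Finset.Ioc (0 : ℤ) (i - 1) = ∅ := Finset.Ioc_eq_empty (by omega)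
    have h3 : Finset.Ioc (i - 1) 0 = insert i (Finset.Ioc i 0) := by
      ext j; simp only [Finset.mem_Ioc, Finset.mem_insert]; omega
    simp only [h1, h2, h3]
    rw [Finset.sum_insert (by simp)]; simp
  · have h1 : Finset.Ioc i (0 : ℤ) = ∅ := Finset.Ioc_eq_empty (by omega)
    have h2 : Finset.Ioc (i - 1) (0 : ℤ) = ∅ := Finset.Ioc_eq_empty (by omega)
    have h3 : Finset.Ioc 0 i = insert i (Finset.Ioc 0 (i - 1)) := by
      ext j; simp only [Finset.mem_Ioc, Finset.mem_insert]; omega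
    simp only [h1, h2, h3]
    rw [Finset.sum_insert (by simp)]; simp; ring

lemma antidifference_add_nat {f F : ℤ → ℤ} (hF : ∀ i, F i = F (i - 1) + f i) (i : ℤ) (k : ℕ) :
    F (i + k) = F i + ∑ j ∈ Finset.range k, f (i + 1 + j) := by
  induction k with
  | zero => simp
  | succ k ih =>
    rw [Finset.sum_range_succ, ← add_assoc, ← ih, hF]
    congr 2 <;> push_cast <;> ring

/-- The discrete Hamiltonian `F - G` of a path is conserved up to a bounded error. -/
lemma IsPath.abs_energy_le {ω η F G : ℤ → ℤ} {m n : ℕ → ℤ} {N : ℕ} (h : IsPath ω η m n N)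
    (hω : ∀ i, ω i = 1 ∨ ω i = -1) (hη : ∀ i, η i = 1 ∨ η i = -1)
    (hF : ∀ i, F i = F (i - 1) + ω i) (hG : ∀ i, G i = G (i - 1) + η i) :
    |(F (m N) - F (m 0)) - (G (n N) - G (n 0))| ≤ 3 := by
  have key : ∀ k ≤ N, 2 * F (m k) - 2 * G (n k) - (1 - η (n k)) * ω (m k) + η (n k) =
      2 * F (m 0) - 2 * G (n 0) - (1 - η (n 0)) * ω (m 0) + η (n 0) := by
    intro k
    induction k with
    | zero => simp
    | succ k ih =>
      intro hk
      rw [← ih (by omega)]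
      obtain ⟨h1, h2⟩ := h k (by omega)
      have hFm : F (m (k + 1)) = if η (n k) = 1 then F (m k) + ω (m (k + 1))
          else F (m k) - ω (m k) := by
        rcases hη (n k) with e | e
        · rw [if_pos e, hF, h1, e, add_sub_cancel_right]
        · rw [if_neg (by rw [e]; decide), h1, e, hF (m k)]
          rw [← sub_eq_add_neg]; ring
      have hGn : G (n (k + 1)) = if ω (m (k + 1)) = 1 then G (n k) + η (n (k + 1))
          else G (n k) - η (n k) := by
        rcases hω (m (k + 1)) with e | e
        · rw [if_pos e, hG, h2, e, add_sub_cancel_right]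
        · rw [if_neg (by rw [e]; decide), h2, e, hG (n k)]
          rw [← sub_eq_add_neg]; ring
      rw [hFm, hGn]
      rcases hη (n k) with e1 | e1 <;> rcases hω (m (k + 1)) with e2 | e2 <;>
        rw [e1, e2] <;> simp <;> ring
  have h1 := key N le_rfl
  rw [abs_le]
  rcases hη (n N) with e1 | e1 <;> rcases hω (m N) with e2 | e2 <;>
  rcases hη (n 0) with e3 | e3 <;> rcases hω (m 0) with e4 | e4 <;>
    rw [e1, e2, e3, e4] at h1 <;> constructor <;> omega

lemma abs_sum_sign_le {ι : Type*} (s : Finset ι) (f : ι → ℤ) (hf : ∀ i, f i = 1 ∨ f i = -1) :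
    |∑ i ∈ s, f i| ≤ s.card := by
  refine (Finset.abs_sum_le_sum_abs _ _).trans ?_
  rw [Finset.sum_congr rfl fun i _ => show |f i| = 1 by rcases hf i with h | h <;> simp [h]]
  simp

lemma odd_sum_sign {ι : Type*} (s : Finset ι) (f : ι → ℤ) (hf : ∀ i, f i = 1 ∨ f i = -1)
    (hs : Odd s.card) : Odd (∑ i ∈ s, f i) := by
  have h1 : Even (∑ i ∈ s, (f i - 1)) :=
    Finset.even_sum _ fun i _ => by rcases hf i with h | h <;> rw [h] <;> decide
  rw [Finset.sum_sub_distrib, Finset.sum_const, nsmul_one] at h1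
  have h2 : Odd (s.card : ℤ) := by exact_mod_cast hs
  simpa using h1.add_odd h2

/-- The antidifference of a `q`-periodic sign sequence is a linear drift up to a bounded error. -/
lemma abs_antidifference_drift {f F : ℤ → ℤ} {q : ℕ} (hq : 0 < q)
    (hf : ∀ i, f i = 1 ∨ f i = -1) (hper : ∀ i, f (i + q) = f i)
    (hF : ∀ i, F i = F (i - 1) + f i) (i j : ℤ) :
    |((F j : ℝ) - F i) - (F q - F 0 : ℤ) * (j - i) / q| ≤ 2 * q := by
  have hS : ∀ i, F (i + q) = F i + (F q - F 0) := by
    intro i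
    induction i using Int.induction_on with
    | zero => simp
    | succ i ih =>
      have h1 := hF (i + 1 + q)
      have h2 := hF (i + 1)
      rw [hper, show (i : ℤ) + 1 + q - 1 = i + q by ring, ih] at h1
      rw [show (i : ℤ) + 1 - 1 = i by ring] at h2
      linarith
    | pred i ih =>
      have h1 := hF (-i + q)
      have h2 := hF (-i)
      rw [hper, show -(i : ℤ) + q - 1 = -i - 1 + q by ring, ih] at h1
      linarith
  have hmul : ∀ (k : ℕ) i, F (i + k * q) = F i + k * (F q - F 0) := by
    intro k
    induction k with
    | zero => simp
    | succ k ih =>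
      intro i
      have := ih (i + q)
      rw [hS] at this
      push_cast
      rw [show i + (k + 1) * (q : ℤ) = i + q + k * q by ring, this]; ring
  wlog hij : i ≤ j generalizing i j
  · have := this j i (by omega)
    rw [← abs_neg] at this
    convert this using 2
    ring
  obtain ⟨d, rfl⟩ := Int.le.dest hij
  have hd := Nat.div_add_mod d q
  set k := d / q
  set r := d % q
  have hr : r < q := Nat.mod_lt _ hq
  have h1 : F (i + d) - F i = k * (F q - F 0) + ∑ j ∈ Finset.range r, f (i + k * q + 1 + j) := by
    rw [show i + (d : ℤ) = i + k * q + r by rw [← hd]; push_cast; ring,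
      antidifference_add_nat hF, hmul]
    ring
  have h2 : |∑ j ∈ Finset.range r, f (i + k * q + 1 + j)| ≤ r := by
    simpa using abs_sum_sign_le (Finset.range r) (fun j => f (i + k * q + 1 + j)) fun j => hf _
  have h3 : |F q - F 0| ≤ q := by
    have := antidifference_add_nat hF 0 q
    rw [zero_add] at this
    rw [this, add_sub_cancel_left]
    simpa using abs_sum_sign_le (Finset.range q) (fun j => f (0 + 1 + j)) fun j => hf _
  have hq' : (0 : ℝ) < q := by exact_mod_cast hq
  have h4 : ((F (i + d) : ℝ) - F i) - (F q - F 0 : ℤ) * ((i + d : ℤ) - i) / q =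
      (∑ j ∈ Finset.range r, f (i + k * q + 1 + j) : ℤ) - (F q - F 0 : ℤ) / q * r := by
    rw [show ((F (i + d) : ℝ) - F i) = ((F (i + d) - F i : ℤ) : ℝ) by push_cast; ring, h1,
      show (((i + d : ℤ) : ℝ) - i) = q * k + r by rw [← hd]; push_cast; ring]
    push_cast; field_simp; ring
  rw [h4]
  refine (abs_sub _ _).trans ?_
  have h5 : |(((F q - F 0 : ℤ) : ℝ) / q * r)| ≤ r := by
    rw [abs_mul, abs_div, Nat.abs_cast, Nat.abs_cast]
    have : |((F q - F 0 : ℤ) : ℝ)| / q ≤ 1 := by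
      rw [div_le_one hq']; exact_mod_cast h3
    nlinarith [show (0 : ℝ) ≤ r from Nat.cast_nonneg r]
  have h6 : |((∑ j ∈ Finset.range r, f (i + k * q + 1 + j) : ℤ) : ℝ)| ≤ r := by exact_mod_cast h2
  have h7 : (r : ℝ) ≤ q := by exact_mod_cast hr.le
  linarith

lemma sum_add_ediv {b : ℕ} (hb : 0 < b) (N : ℤ) :
    ∑ i ∈ Finset.range b, (N + i) / (b : ℤ) = N := by
  have hb' : (b : ℤ) ≠ 0 := by exact_mod_cast hb.ne'
  have hstep : ∀ N : ℤ, ∑ i ∈ Finset.range b, (N + 1 + i) / (b : ℤ) =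
      ∑ i ∈ Finset.range b, (N + i) / (b : ℤ) + 1 := by
    intro N
    have h1 := Finset.sum_range_succ (fun i : ℕ => (N + i) / (b : ℤ)) b
    have h2 := Finset.sum_range_succ' (fun i : ℕ => (N + i) / (b : ℤ)) b
    rw [Int.add_ediv_of_dvd_right (dvd_refl _), Int.ediv_self hb'] at h1
    have h3 : ∑ i ∈ Finset.range b, (N + 1 + i) / (b : ℤ) =
        ∑ i ∈ Finset.range b, (N + ((i + 1 : ℕ) : ℤ)) / (b : ℤ) :=
      Finset.sum_congr rfl fun i _ => by push_cast; ring_nf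
    rw [h3]
    simp only [Nat.cast_zero, add_zero] at h2
    linarith
  induction N using Int.induction_on with
  | zero =>
    refine Finset.sum_eq_zero fun i hi => ?_
    rw [zero_add]
    exact Int.ediv_eq_zero_of_lt (by positivity) (by exact_mod_cast Finset.mem_range.1 hi)
  | succ i ih => rw [hstep, ih]
  | pred i ih =>
    have := hstep (-i - 1)
    rw [sub_add_cancel, ih] at this
    linarith

/-- Hermite's identity. -/
lemma sum_floor_add_div {b : ℕ} (hb : 0 < b) (x : ℝ) :
    ∑ i ∈ Finset.range b, ⌊x + (i : ℝ) / b⌋ = ⌊b * x⌋ := by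
  have hb' : (0 : ℝ) < b := by exact_mod_cast hb
  rw [← sum_add_ediv hb ⌊b * x⌋]
  refine Finset.sum_congr rfl fun i _ => ?_
  rw [show x + (i : ℝ) / b = (b * x + (i : ℤ)) / (b : ℝ) by push_cast; field_simp,
    Int.floor_div_natCast, Int.floor_add_intCast]

lemma halfSign_eq_floor (x : ℝ) : halfSign x = 1 - 2 * (⌊x + 1 / 2⌋ - ⌊x⌋) := by
  have h1 := Int.floor_add_fract x
  have h0 := Int.fract_nonneg x
  have h2 := Int.fract_lt_one x
  unfold halfSign
  split_ifs with h
  · have : ⌊x + 1 / 2⌋ = ⌊x⌋ := by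
      rw [Int.floor_eq_iff]; constructor <;> linarith
    rw [this]; ring
  · have : ⌊x + 1 / 2⌋ = ⌊x⌋ + 1 := by
      rw [Int.floor_eq_iff]; push_cast; constructor <;> linarith
    rw [this]; ring

lemma sum_range_mul_coprime {a : ℤ} {b : ℕ} (hb : 0 < b) (hab : IsCoprime a b) {h : ℤ → ℤ}
    (hper : ∀ i k : ℤ, h (i + k * b) = h i) :
    ∑ i ∈ Finset.range b, h (i * a) = ∑ i ∈ Finset.range b, h i := by
  have : NeZero b := ⟨hb.ne'⟩
  have hmod : ∀ i j : ℤ, (i : ZMod b) = j → h i = h j := by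
    intro i j hij
    rw [ZMod.intCast_eq_intCast_iff_dvd_sub] at hij
    obtain ⟨k, hk⟩ := hij
    rw [← hper i k]; congr 1; linarith
  have hsum : ∀ g : ZMod b → ℤ, ∑ i ∈ Finset.range b, g (i : ZMod b) = ∑ z, g z := by
    intro g
    refine Finset.sum_bij' (fun i _ => (i : ZMod b)) (fun z _ => z.val) ?_ ?_ ?_ ?_ ?_
    · simp
    · intro z _; exact Finset.mem_range.2 z.val_lt
    · intro i hi; exact ZMod.val_cast_of_lt (Finset.mem_range.1 hi)
    · intro z _; simp
    · simp
  have hu : IsUnit (a : ZMod b) := by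
    obtain ⟨u, v, huv⟩ := hab
    refine IsUnit.of_mul_eq_one (u : ZMod b) ?_
    have := congrArg (Int.cast : ℤ → ZMod b) huv
    push_cast at this
    rw [ZMod.natCast_self, mul_zero, add_zero] at this
    rw [mul_comm, this]
  have e1 : ∀ i : ℕ, h (i * a) = (fun z : ZMod b => h (z.val : ℤ)) ((i : ZMod b) * a) := by
    intro i; apply hmod; push_cast; rw [ZMod.natCast_val, ZMod.cast_id', id]
  have e2 : ∀ i : ℕ, h i = (fun z : ZMod b => h (z.val : ℤ)) (i : ZMod b) := by
    intro i; apply hmod; push_cast; rw [ZMod.natCast_val, ZMod.cast_id', id]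
  rw [Finset.sum_congr rfl fun i _ => e1 i, Finset.sum_congr rfl fun i _ => e2 i,
    hsum fun z => h ((z * a).val : ℤ), hsum fun z => h (z.val : ℤ)]
  obtain ⟨w, hw⟩ := hu
  rw [← hw]
  exact Equiv.sum_comp (Units.mulRight w) fun z : ZMod b => h (z.val : ℤ)

lemma abs_sum_halfSign_le_one {a : ℤ} {b : ℕ} (hb : Odd b) (hab : IsCoprime a b) (x : ℝ) :
    |∑ i ∈ Finset.range b, halfSign (x + i * (a / b))| ≤ 1 := by
  have hb0 : 0 < b := hb.pos
  have hb' : (b : ℝ) ≠ 0 := by exact_mod_cast hb0.ne'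
  have h1 := sum_range_mul_coprime hb0 hab (h := fun i : ℤ => halfSign (x + i / b)) (by
    intro i k
    rw [show x + ((i + k * b : ℤ) : ℝ) / b = x + i / b + k by push_cast; field_simp; ring,
      halfSign_add_int])
  have h2 : ∀ i : ℕ, halfSign (x + i * (a / b)) = halfSign (x + ((i * a : ℤ) : ℝ) / b) := by
    intro i; congr 2; push_cast; ring
  rw [Finset.sum_congr rfl fun i _ => h2 i, h1]
  have h3 : ∀ i : ℕ, halfSign (x + ((i : ℤ) : ℝ) / b) =
      1 - 2 * (⌊x + 1 / 2 + (i : ℝ) / b⌋ - ⌊x + (i : ℝ) / b⌋) := by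
    intro i; rw [halfSign_eq_floor]; push_cast; ring_nf
  rw [Finset.sum_congr rfl fun i _ => h3 i, Finset.sum_sub_distrib, ← Finset.mul_sum,
    Finset.sum_sub_distrib, sum_floor_add_div hb0, sum_floor_add_div hb0]
  obtain ⟨c, hc⟩ := hb
  have h4 : ⌊(b : ℝ) * (x + 1 / 2)⌋ = ⌊b * x + 1 / 2⌋ + c := by
    rw [← Int.floor_add_intCast]; congr 1; rw [hc]; push_cast; ring
  have h5 : ⌊b * x + 1 / 2⌋ = ⌊b * x⌋ ∨ ⌊b * x + 1 / 2⌋ = ⌊b * x⌋ + 1 := by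
    have h6 : ⌊b * x⌋ ≤ ⌊b * x + 1 / 2⌋ := Int.floor_mono (by linarith)
    have h7 : ⌊b * x + 1 / 2⌋ ≤ ⌊b * x⌋ + 1 := by
      rw [← Int.floor_add_one]; exact Int.floor_mono (by linarith)
    omega
  rw [h4]
  simp only [Finset.sum_const, Finset.card_range]
  rw [abs_le]
  rcases h5 with h | h <;> rw [h] <;> simp <;> constructor <;> omega

/-- Paths in the sign pattern of slopes `(α, β)` have vertical speed at most `v`. -/
def VertBound (α β C v : ℝ) : Prop :=
  ∀ (x y : ℝ) (m n : ℕ → ℤ) (N : ℕ),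
    IsPath (fun i => halfSign (x + i * α)) (fun j => halfSign (y + j * β)) m n N →
      |(n N : ℝ) - n 0| ≤ C + v * N

/-- Paths in the sign pattern of slopes `(α, β)` have horizontal speed at most `v`. -/
def HorizBound (α β C v : ℝ) : Prop :=
  ∀ (x y : ℝ) (m n : ℕ → ℤ) (N : ℕ),
    IsPath (fun i => halfSign (x + i * α)) (fun j => halfSign (y + j * β)) m n N →
      |(m N : ℝ) - m 0| ≤ C + v * N

lemma abs_halfSign (x : ℝ) : |halfSign x| = 1 := by
  rcases halfSign_eq_or x with h | h <;> rw [h] <;> rfl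

lemma vertBound_one (α β : ℝ) : VertBound α β 0 1 := by
  intro x y m n N h
  rw [zero_add, one_mul]
  induction N with
  | zero => simp
  | succ N ih =>
    have h1 := ih fun k hk => h k (by omega)
    have h2 := (h N (by omega)).2
    have h3 := abs_halfSign (x + m (N + 1) * α)
    have h4 : |((halfSign (x + m (N + 1) * α) : ℤ) : ℝ)| = 1 := by exact_mod_cast h3
    rw [h2]; push_cast
    calc _ = |((n N : ℝ) - n 0) + (halfSign (x + m (N + 1) * α) : ℤ)| := by congr 1; ring
      _ ≤ _ := (abs_add_le _ _).trans (by linarith)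

lemma HorizBound.swap {α β C v : ℝ} (hC : 0 ≤ C) (hv : 0 ≤ v) (h : HorizBound α β C v) :
    VertBound β α (C + 1) v := by
  intro x y m n N hp
  rcases N with _ | N
  · simp; linarith
  have h1 := h y x n (fun k => m (k + 1)) N fun k hk =>
    ⟨(hp k (by omega)).2, (hp (k + 1) (by omega)).1⟩
  have h2 := (hp N (by omega)).2
  have h4 : |((halfSign (x + m (N + 1) * β) : ℤ) : ℝ)| = 1 := by
    exact_mod_cast abs_halfSign (x + m (N + 1) * β)
  rw [h2]; push_cast
  calc _ = |((n N : ℝ) - n 0) + (halfSign (x + m (N + 1) * β) : ℤ)| := by congr 1; ring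
    _ ≤ _ := (abs_add_le _ _).trans (by nlinarith)

/-- Slightly increasing a rational second slope increases the vertical speed bound by arbitrarily
little. -/
lemma VertBound.exists_perturb {α C v v' : ℝ} {p : ℤ} {q : ℕ} (hq : 0 < q)
    (h : VertBound α (p / q) C v) (hC : 0 ≤ C) (hv : 0 ≤ v) (hvv : v < v') :
    ∃ δ > 0, ∀ β', (p / q : ℝ) < β' → β' < p / q + δ → ∃ C' ≥ 0, VertBound α β' C' v' := by
  have hq' : (0 : ℝ) < q := by exact_mod_cast hq
  obtain ⟨L₀, hL₀, hL⟩ := exists_block_length hv hvv (C + 2) (by linarith)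
  refine ⟨1 / (2 * q * L₀), by positivity, fun β' hβ hβ' => ?_⟩
  set L := 1 / (2 * q * (β' - p / q)) with hLdef
  have hτ : 0 < β' - p / q := sub_pos.2 hβ
  have hLpos : 0 < L := by positivity
  have hL0L : L₀ ≤ L := by
    rw [hLdef, le_div_iff₀ (by positivity)]
    have : β' - p / q < 1 / (2 * q * L₀) := by linarith
    rw [lt_div_iff₀ (by positivity)] at this
    linarith
  have hβL : β' = p / q + 1 / (2 * q * L) := by
    rw [hLdef]; field_simp; ring
  obtain ⟨T, hT, hT1, hT2⟩ := hL L hL0L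
  refine ⟨2 * L, by positivity, fun x y m n N hp => ?_⟩
  have hT' : (0 : ℝ) < T := by exact_mod_cast hT
  have hstep : ∀ k < N, |(n (k + 1) : ℝ) - n k| = 1 := by
    intro k hk
    rw [(hp k hk).2]; push_cast; rw [add_sub_cancel_left]
    exact_mod_cast abs_halfSign _
  have key := abs_sub_le_of_crossing n (2 * q * y) L hLpos T hT N ?_
  · refine key.trans ?_
    have : L * (N / T) ≤ v' * N := by
      rw [mul_div_assoc', div_le_iff₀ hT']
      nlinarith [show (0 : ℝ) ≤ N from Nat.cast_nonneg N]
    linarith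
  · intro a b J hab hbN hLab hJ
    by_contra! hTba
    have hvT : v * (b - a) ≤ v * T := by
      apply mul_le_mul_of_nonneg_left _ hv
      rw [← Nat.cast_sub hab.le]; exact_mod_cast hTba
    have hab0 : (0 : ℝ) ≤ v * T := by positivity
    rcases Nat.lt_or_ge b (a + 2) with hb | hb
    · obtain rfl : b = a + 1 := by omega
      have := hstep a (by omega)
      linarith
    · obtain ⟨d, rfl⟩ := Nat.exists_eq_add_of_le hb
      have h1 := h x (J / (2 * q)) (fun k => m (a + 1 + k)) (fun k => n (a + 1 + k)) d
        fun k hk => by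
          obtain ⟨e1, e2⟩ := hp (a + 1 + k) (by omega)
          refine ⟨?_, e2⟩
          have := halfSign_perturb p hq hLpos y (n (a + 1 + k)) J
            (hJ _ (by omega) (by omega))
          rw [← hβL] at this
          simp only [← this]
          exact e1
      have h2 := hstep a (by omega)
      have h3 := hstep (a + 1 + d) (by omega)
      rw [show a + 1 + d + 1 = a + 2 + d by ring] at h3
      simp only [add_zero] at h1
      have h4 : |(n (a + 2 + d) : ℝ) - n a| ≤ C + v * d + 2 := by
        rw [abs_le] at h1 ⊢
        have h2' := abs_le.1 h2.le
        have h3' := abs_le.1 h3.le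
        constructor <;> linarith [h1.1, h1.2, h2'.1, h2'.2, h3'.1, h3'.2]
      push_cast at hvT
      nlinarith

lemma VertBound.exists_horizBound {β' C v v' : ℝ} {p a : ℤ} {q b : ℕ} (hq : Odd q) (hb : Odd b)
    (hab : IsCoprime a b) (hβ' : β' = a / b)
    (h : VertBound (p / q) β' C v) (hC : 0 ≤ C) (hv : 0 ≤ v) (hvv : q * v / b < v') :
    ∃ δ > 0, ∀ α', (p / q : ℝ) < α' → α' < p / q + δ → ∃ C' ≥ 0, HorizBound α' β' C' v' := by
  have hq0 := hq.pos
  have hb0 := hb.pos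
  have hq' : (0 : ℝ) < q := by exact_mod_cast hq0
  have hb' : (0 : ℝ) < b := by exact_mod_cast hb0
  set C₂ : ℝ := 2 + q * (3 + 2 * q + 2 * b + C / b) with hC₂
  obtain ⟨L₀, hL₀, hL⟩ := exists_block_length (v := q * v / b) (by positivity) hvv C₂
    (by positivity)
  refine ⟨1 / (2 * q * L₀), by positivity, fun α' hα hα' => ?_⟩
  set L := 1 / (2 * q * (α' - p / q)) with hLdef
  have hτ : 0 < α' - p / q := sub_pos.2 hα
  have hLpos : 0 < L := by positivity
  have hL0L : L₀ ≤ L := by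
    rw [hLdef, le_div_iff₀ (by positivity)]
    have : α' - p / q < 1 / (2 * q * L₀) := by linarith
    rw [lt_div_iff₀ (by positivity)] at this
    linarith
  have hαL : α' = p / q + 1 / (2 * q * L) := by
    rw [hLdef]; field_simp; ring
  obtain ⟨T, hT, hT1, hT2⟩ := hL L hL0L
  refine ⟨2 * L, by positivity, fun x y m n N hp => ?_⟩
  have hT' : (0 : ℝ) < T := by exact_mod_cast hT
  have hstep : ∀ k < N, |(m (k + 1) : ℝ) - m k| = 1 := by
    intro k hk
    rw [(hp k hk).1]; push_cast; rw [add_sub_cancel_left]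
    exact_mod_cast abs_halfSign _
  have key := abs_sub_le_of_crossing m (2 * q * x) L hLpos T hT N ?_
  · refine key.trans ?_
    have : L * (N / T) ≤ v' * N := by
      rw [mul_div_assoc', div_le_iff₀ hT']
      nlinarith [show (0 : ℝ) ≤ N from Nat.cast_nonneg N]
    linarith
  · intro s t J hst htN hLst hJ
    by_contra! hTst
    have hvT : q * v / b * (t - s) ≤ q * v / b * T := by
      apply mul_le_mul_of_nonneg_left _ (by positivity)
      rw [← Nat.cast_sub hst.le]; exact_mod_cast hTst
    have hab0 : (0 : ℝ) ≤ q * v / b * T := by positivity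
    have hC2 : 2 ≤ C₂ := by rw [hC₂]; linarith [show 0 ≤ q * (3 + 2 * q + 2 * b + C / b) by positivity]
    rcases Nat.lt_or_ge t (s + 2) with ht | ht
    · obtain rfl : t = s + 1 := by omega
      have := hstep s (by omega)
      linarith
    · obtain ⟨d, rfl⟩ := Nat.exists_eq_add_of_le ht
      set ω : ℤ → ℤ := fun i => halfSign (J / (2 * q) + i * (p / q)) with hω
      set η : ℤ → ℤ := fun j => halfSign (y + j * β') with hη
      have hpath : IsPath ω η (fun k => m (s + 1 + k)) (fun k => n (s + 1 + k)) d := by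
        intro k hk
        obtain ⟨e1, e2⟩ := hp (s + 1 + k) (by omega)
        refine ⟨e1, ?_⟩
        have := halfSign_perturb p hq0 hLpos x (m (s + 1 + k + 1)) J
          (hJ _ (by omega) (by omega))
        rw [← hαL] at this
        simp only at e2
        rw [this] at e2
        exact e2
      have h1 := h (J / (2 * q)) y _ _ d hpath
      obtain ⟨F, hF⟩ := exists_antidifference ω
      obtain ⟨G, hG⟩ := exists_antidifference η
      have hωper : ∀ i, ω (i + q) = ω i := by
        intro i
        simp only [hω]
        rw [← halfSign_add_int (J / (2 * q) + i * (p / q)) p]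
        congr 1; push_cast; field_simp; ring
      have hηper : ∀ i, η (i + b) = η i := by
        intro i
        simp only [hη]
        rw [← halfSign_add_int (y + i * β') a, hβ']
        congr 1; push_cast; field_simp; ring
      have hS : 1 ≤ |F q - F 0| := by
        have e := antidifference_add_nat hF 0 q
        rw [zero_add] at e
        rw [e, add_sub_cancel_left]
        have := odd_sum_sign (Finset.range q) (fun j => ω (0 + 1 + j)) (fun j => halfSign_eq_or _)
          (by simpa using hq)
        rcases this with ⟨c, hc⟩
        rw [hc]; apply Int.one_le_abs; omega
      have hS' : |G b - G 0| ≤ 1 := by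
        have e := antidifference_add_nat hG 0 b
        rw [zero_add] at e
        rw [e, add_sub_cancel_left]
        convert abs_sum_halfSign_le_one hb hab (y + β') using 3 with i
        simp only [hη]
        congr 1
        rw [hβ']; push_cast; ring
      have hE := hpath.abs_energy_le (fun i => halfSign_eq_or _) (fun i => halfSign_eq_or _) hF hG
      have hdF := abs_antidifference_drift hq0 (fun i => halfSign_eq_or _) hωper hF
        (m (s + 1)) (m (s + 1 + d))
      have hdG := abs_antidifference_drift hb0 (fun i => halfSign_eq_or _) hηper hG
        (n (s + 1)) (n (s + 1 + d))
      simp only [add_zero] at hE h1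
      set D := |(m (s + 1 + d) : ℝ) - m (s + 1)| with hD
      have hF1 : D / q ≤ |(F (m (s + 1 + d)) : ℝ) - F (m (s + 1))| + 2 * q := by
        have e1 : D / q ≤ |((F q - F 0 : ℤ) : ℝ) * (m (s + 1 + d) - m (s + 1)) / q| := by
          rw [abs_div, abs_mul, Nat.abs_cast]
          gcongr
          have : (1 : ℝ) ≤ |((F q - F 0 : ℤ) : ℝ)| := by exact_mod_cast hS
          nlinarith [abs_nonneg ((m (s + 1 + d) : ℝ) - m (s + 1))]
        have e2 := abs_sub_abs_le_abs_sub
          (((F q - F 0 : ℤ) : ℝ) * (m (s + 1 + d) - m (s + 1)) / q)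
          ((F (m (s + 1 + d)) : ℝ) - F (m (s + 1)))
        rw [abs_sub_comm] at hdF
        linarith
      have hG1 : |(G (n (s + 1 + d)) : ℝ) - G (n (s + 1))| ≤ (C + v * d) / b + 2 * b := by
        have e1 : |((G b - G 0 : ℤ) : ℝ) * (n (s + 1 + d) - n (s + 1)) / b| ≤ (C + v * d) / b := by
          rw [abs_div, abs_mul, Nat.abs_cast]
          gcongr
          have : |((G b - G 0 : ℤ) : ℝ)| ≤ 1 := by exact_mod_cast hS'
          nlinarith [abs_nonneg ((n (s + 1 + d) : ℝ) - n (s + 1))]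
        have e2 := abs_sub_abs_le_abs_sub
          ((G (n (s + 1 + d)) : ℝ) - G (n (s + 1)))
          (((G b - G 0 : ℤ) : ℝ) * (n (s + 1 + d) - n (s + 1)) / b)
        linarith
      have hE' : |((F (m (s + 1 + d)) : ℝ) - F (m (s + 1)))
          - (G (n (s + 1 + d)) - G (n (s + 1)))| ≤ 3 := by exact_mod_cast hE
      have e3 := abs_sub_abs_le_abs_sub ((F (m (s + 1 + d)) : ℝ) - F (m (s + 1)))
        ((G (n (s + 1 + d)) : ℝ) - G (n (s + 1)))
      have h5 : D / q ≤ 3 + 2 * q + 2 * b + (C + v * d) / b := by linarith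
      have h6 : D ≤ q * (3 + 2 * q + 2 * b + C / b) + q * v / b * d := by
        rw [div_le_iff₀ hq'] at h5
        refine h5.trans (le_of_eq ?_)
        ring
      have h2 := hstep s (by omega)
      have h3 := hstep (s + 1 + d) (by omega)
      rw [show s + 1 + d + 1 = s + 2 + d by ring] at h3
      have h4 : |(m (s + 2 + d) : ℝ) - m s| ≤ D + 2 := by
        have hD' := abs_le.1 hD.ge
        rw [abs_le]
        have h2' := abs_le.1 h2.le
        have h3' := abs_le.1 h3.le
        constructor <;> linarith [hD'.1, hD'.2, h2'.1, h2'.2, h3'.1, h3'.2]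
      have h7 : q * v / b * d ≤ q * v / b * T := by
        refine le_trans ?_ hvT
        apply mul_le_mul_of_nonneg_left _ (by positivity)
        push_cast; linarith
      linarith

/-- Rational slopes `(α, β)`, the first of odd denominator `q`, whose vertical speed is at most
some `v` with `q v < κ`. -/
def IsSlow (κ α β : ℝ) : Prop :=
  ∃ (p : ℤ) (q : ℕ) (r : ℚ) (C v : ℝ), Odd q ∧ α = p / q ∧ β = r ∧ 0 ≤ C ∧ 0 ≤ v ∧
    VertBound α β C v ∧ q * v < κ

lemma isSlow_of_odd_den (r s : ℚ) (hr : Odd r.den) : IsSlow (r.den + 1) r s :=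
  ⟨r.num, r.den, s, 0, 1, hr, Rat.cast_def r, rfl, le_rfl, zero_le_one, vertBound_one _ _,
    by linarith⟩

lemma exists_odd_den_btwn {x y : ℝ} (h : x < y) : ∃ r : ℚ, Odd r.den ∧ x < r ∧ (r : ℝ) < y := by
  obtain ⟨N, hN⟩ := exists_nat_one_div_lt (sub_pos.2 h)
  set d : ℕ := 2 * N + 1 with hd
  have hd0 : (0 : ℝ) < d := by positivity
  refine ⟨((⌊x * d⌋ + 1 : ℤ) : ℚ) / (d : ℤ), ?_, ?_, ?_⟩
  · have h1 : ((((⌊x * d⌋ + 1 : ℤ) : ℚ) / (d : ℤ)).den : ℤ) ∣ d := by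
      rw [← Rat.divInt_eq_div]; exact Rat.den_dvd _ _
    exact Odd.of_dvd_nat ⟨N, hd⟩ (by exact_mod_cast h1)
  · push_cast
    rw [lt_div_iff₀ hd0]; exact Int.lt_floor_add_one _
  · push_cast
    have h1 := Int.floor_le (x * d)
    rw [div_lt_iff₀ hd0]
    have h2 : 1 < (y - x) * d := by
      rw [div_lt_iff₀ (by positivity)] at hN
      refine hN.trans_le ?_
      apply mul_le_mul_of_nonneg_left _ (sub_pos.2 h).le
      rw [hd]; push_cast; linarith [show (0 : ℝ) ≤ N from Nat.cast_nonneg N]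
    linarith

lemma IsSlow.exists_swap {κ α β ε : ℝ} (h : IsSlow κ α β) (hε : 0 < ε) :
    ∃ α' β', α < α' ∧ α' < α + ε ∧ β < β' ∧ β' < β + ε ∧ IsSlow κ β' α' := by
  obtain ⟨p, q, r, C, v, hq, hα, hβ, hC, hv, hV, hκ⟩ := h
  have hq' : (0 : ℝ) < q := by exact_mod_cast hq.pos
  obtain ⟨v₁, hv₁, hv₁κ⟩ := exists_between ((lt_div_iff₀' hq').2 hκ)
  rw [lt_div_iff₀' hq'] at hv₁κ
  rw [hβ, Rat.cast_def] at hV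
  obtain ⟨δ, hδ, hA⟩ := hV.exists_perturb r.den_pos hC hv hv₁
  rw [← Rat.cast_def, ← hβ] at hA
  obtain ⟨s, hs, hs1, hs2⟩ := exists_odd_den_btwn (lt_add_of_pos_right β (lt_min hδ hε))
  obtain ⟨C₁, hC₁, hV₁⟩ := hA s hs1 (by linarith [min_le_left δ ε])
  have hs' : (0 : ℝ) < s.den := by exact_mod_cast hs.pos
  obtain ⟨v₂, hv₂, hv₂κ⟩ := exists_between ((div_lt_div_iff_of_pos_right hs').2 hv₁κ)
  rw [lt_div_iff₀' hs'] at hv₂κ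
  rw [hα] at hV₁
  obtain ⟨δ', hδ', hB⟩ := hV₁.exists_horizBound hq hs
    (by rw [Int.isCoprime_iff_nat_coprime]; simpa using s.reduced) (Rat.cast_def s) hC₁
    (hv.trans hv₁.le) hv₂
  rw [← hα] at hB
  obtain ⟨t, ht1, ht2⟩ := exists_rat_btwn (lt_add_of_pos_right α (lt_min hδ' hε))
  obtain ⟨C₂, hC₂, hH⟩ := hB t ht1 (by linarith [min_le_left δ' ε])
  have hv₂0 : 0 ≤ v₂ := le_trans (by have := hv.trans hv₁.le; positivity) hv₂.le
  exact ⟨t, s, ht1, by linarith [min_le_right δ' ε], hs1, by linarith [min_le_right δ ε],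
    s.num, s.den, t, C₂ + 1, v₂, hs, Rat.cast_def s, rfl, by linarith, hv₂0, hH.swap hC₂ hv₂0, hv₂κ⟩

lemma IsSlow.exists_near {κ α β ε : ℝ} (h : IsSlow κ α β) (hε : 0 < ε) :
    ∃ α' β', α < α' ∧ α' < α + ε ∧ β < β' ∧ β' < β + ε ∧ IsSlow κ α' β' := by
  obtain ⟨a, b, h1, h2, h3, h4, h5⟩ := h.exists_swap (half_pos hε)
  obtain ⟨b', a', g1, g2, g3, g4, g5⟩ := h5.exists_swap (half_pos hε)
  exact ⟨a', b', by linarith, by linarith, by linarith, by linarith, g5⟩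

/-- Points of the closure of the slow pairs with irrational coordinates are dense in it. -/
lemma exists_irrational_mem_closure_isSlow {κ : ℝ} {U : Set (ℝ × ℝ)} (hU : IsOpen U) {z : ℝ × ℝ}
    (hz : IsSlow κ z.1 z.2) (hzU : z ∈ U) :
    ∃ w ∈ U, w ∈ closure {w : ℝ × ℝ | IsSlow κ w.1 w.2} ∧ Irrational w.1 ∧ Irrational w.2 := by
  set S := {w : ℝ × ℝ | IsSlow κ w.1 w.2} with hS
  have : CompleteSpace (closure S) := isClosed_closure.completeSpace_coe
  have hd : Dense (⋂ t : ℚ, {w : closure S | w.1.1 ≠ t ∧ w.1.2 ≠ t}) := by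
    refine dense_iInter_of_isOpen (fun t => ?_) fun t => ?_
    · exact (isOpen_ne_fun (by fun_prop) (by fun_prop)).inter
        (isOpen_ne_fun (by fun_prop) (by fun_prop))
    · rw [Metric.dense_iff]
      rintro ⟨w, hw⟩ ε hε
      obtain ⟨⟨a, b⟩, hab, hwab⟩ := Metric.mem_closure_iff.1 hw (ε / 2) (half_pos hε)
      have hη : ∃ η > 0, η ≤ ε / 2 ∧ (a < t → η ≤ t - a) ∧ (b < t → η ≤ t - b) := by
        refine ⟨min (ε / 2) (min (if a < t then t - a else 1) (if b < t then t - b else 1)),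
          ?_, min_le_left _ _, fun h => ?_, fun h => ?_⟩
        · refine lt_min (half_pos hε) (lt_min ?_ ?_) <;> split_ifs <;> linarith
        · refine (min_le_right _ _).trans ((min_le_left _ _).trans ?_); rw [if_pos h]
        · refine (min_le_right _ _).trans ((min_le_right _ _).trans ?_); rw [if_pos h]
      obtain ⟨η, hη, hηε, hηa, hηb⟩ := hη
      obtain ⟨a', b', h1, h2, h3, h4, h5⟩ := IsSlow.exists_near hab hη
      refine ⟨⟨(a', b'), subset_closure h5⟩, ?_, ?_, ?_⟩
      · rw [Metric.mem_ball, Subtype.dist_eq]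
        have : dist (a', b') (a, b) < ε / 2 := by
          rw [Prod.dist_eq, max_lt_iff, Real.dist_eq, Real.dist_eq, abs_lt, abs_lt]
          constructor <;> constructor <;> simp only <;> linarith
        calc dist (a', b') w ≤ dist (a', b') (a, b) + dist (a, b) w := dist_triangle _ _ _
          _ < ε := by rw [dist_comm (a, b)]; linarith
      · rintro rfl
        have := hηa h1
        linarith
      · rintro rfl
        have := hηb h3
        linarith
  obtain ⟨w, hwU, hw⟩ := hd.exists_mem_open (hU.preimage continuous_subtype_val)
    ⟨⟨z, subset_closure hz⟩, hzU⟩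
  rw [Set.mem_iInter] at hwU
  exact ⟨w, hw, w.2, fun ⟨t, ht⟩ => (hwU t).1 ht.symm, fun ⟨t, ht⟩ => (hwU t).2 ht.symm⟩

lemma halfSign_periodic : Function.Periodic halfSign 1 := fun x => by
  simpa using halfSign_add_int x 1

/-- The square wave `halfSign` as a function on the circle `ℝ/ℤ`. -/
noncomputable def circSign : UnitAddCircle → ℤ := halfSign_periodic.lift

@[simp] lemma circSign_coe (x : ℝ) : circSign (x : UnitAddCircle) = halfSign x :=
  halfSign_periodic.lift_coe x

lemma circSign_eq_or (x : UnitAddCircle) : circSign x = 1 ∨ circSign x = -1 := by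
  induction x using QuotientAddGroup.induction_on with
  | H x => exact halfSign_eq_or x

lemma measurable_halfSign : Measurable halfSign :=
  Measurable.ite (measurableSet_lt measurable_fract measurable_const) measurable_const
    measurable_const

lemma measurable_circSign : Measurable circSign := by
  have : circSign = fun x => halfSign (AddCircle.measurableEquivIco 1 0 x) := by
    ext x
    conv_lhs => rw [← (AddCircle.equivIco (1 : ℝ) 0).symm_apply_apply x]
    exact circSign_coe _
  rw [this]
  exact measurable_halfSign.comp
    (measurable_subtype_coe.comp (AddCircle.measurableEquivIco 1 0).measurable)

/-- One double step of the walk on `ℤ²` driven by the base point `p` of the torus. -/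
noncomputable def walkStep (α β : ℝ) (p : UnitAddCircle × UnitAddCircle) (z : ℤ × ℤ) : ℤ × ℤ :=
  (z.1 + circSign (p.2 + (z.2 * β : ℝ)),
    z.2 + circSign (p.1 + ((z.1 + circSign (p.2 + (z.2 * β : ℝ)) : ℤ) * α : ℝ)))

/-- The walk on `ℤ²` started at the origin. -/
noncomputable def walk (α β : ℝ) (p : UnitAddCircle × UnitAddCircle) (k : ℕ) : ℤ × ℤ :=
  (walkStep α β p)^[k] 0

/-- The points of the torus whose walk returns to the origin within `n` steps. -/
def closedWithin (α β : ℝ) (n : ℕ) : Set (UnitAddCircle × UnitAddCircle) :=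
  {p | ∃ k, 1 ≤ k ∧ k ≤ n ∧ walk α β p k = 0}

/-- The map of the torus `(ℝ/ℤ)²` whose orbits are followed by `walk`. -/
noncomputable def walkMap (α β : ℝ) (p : UnitAddCircle × UnitAddCircle) :
    UnitAddCircle × UnitAddCircle :=
  (p.1 + (circSign p.2 * α : ℝ), p.2 + (circSign (p.1 + (circSign p.2 * α : ℝ)) * β : ℝ))

lemma walk_succ (α β : ℝ) (p : UnitAddCircle × UnitAddCircle) (k : ℕ) :
    walk α β p (k + 1) = walkStep α β p (walk α β p k) :=
  Function.iterate_succ_apply' _ _ _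

lemma walkMap_iterate (α β : ℝ) (p : UnitAddCircle × UnitAddCircle) (k : ℕ) :
    (walkMap α β)^[k] p =
      (p.1 + ((walk α β p k).1 * α : ℝ), p.2 + ((walk α β p k).2 * β : ℝ)) := by
  induction k with
  | zero => simp [walk]
  | succ k ih =>
    rw [Function.iterate_succ_apply', ih, walk_succ]
    simp only [walkMap, walkStep, Int.cast_add, add_mul, AddCircle.coe_add, add_assoc]

lemma isPath_walk (α β x y : ℝ) (N : ℕ) :
    IsPath (fun i => halfSign (x + i * α)) (fun j => halfSign (y + j * β))
      (fun k => (walk α β (x, y) k).1) (fun k => (walk α β (x, y) k).2) N := by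
  intro k _
  beta_reduce
  rw [walk_succ]
  simp only [walkStep, ← AddCircle.coe_add, circSign_coe, and_self]

lemma measurable_walk (α β : ℝ) (k : ℕ) : Measurable fun p => walk α β p k := by
  induction k with
  | zero => exact measurable_const
  | succ k ih =>
    have hcoe : ∀ (γ : ℝ) {f : UnitAddCircle × UnitAddCircle → ℤ}, Measurable f →
        Measurable fun p => ((f p * γ : ℝ) : UnitAddCircle) := fun γ f hf =>
      (Measurable.of_discrete (f := fun i : ℤ => ((i * γ : ℝ) : UnitAddCircle))).comp hf
    have h1 : Measurable fun p => (walk α β p k).1 + circSign (p.2 + ((walk α β p k).2 * β : ℝ)) :=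
      ih.fst.add (measurable_circSign.comp (measurable_snd.add (hcoe β ih.snd)))
    simp only [walk_succ, walkStep]
    exact h1.prodMk (ih.snd.add (measurable_circSign.comp (measurable_fst.add (hcoe α h1))))

lemma measurableSet_closedWithin (α β : ℝ) (n : ℕ) : MeasurableSet (closedWithin α β n) := by
  have : closedWithin α β n = ⋃ k ∈ Set.Icc 1 n, {p | walk α β p k = 0} := by
    ext p; simp [closedWithin, and_assoc]
  rw [this]
  exact MeasurableSet.biUnion (Set.to_countable _) fun k _ =>
    measurable_walk α β k (measurableSet_singleton 0)

lemma measurePreserving_walkMap (α β : ℝ) : MeasurePreserving (walkMap α β) := by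
  have hm : ∀ γ : ℝ, Measurable fun x : UnitAddCircle => ((circSign x * γ : ℝ) : UnitAddCircle) :=
    fun γ => (Measurable.of_discrete (f := fun i : ℤ => ((i * γ : ℝ) : UnitAddCircle))).comp
      measurable_circSign
  have h : ∀ γ : ℝ, MeasurePreserving fun p : UnitAddCircle × UnitAddCircle =>
      (p.1, p.2 + (circSign p.1 * γ : ℝ)) := fun γ =>
    MeasurePreserving.skew_product
      (g := fun x y : UnitAddCircle => y + ((circSign x * γ : ℝ) : UnitAddCircle))
      (MeasurePreserving.id _)
      (measurable_snd.add ((hm γ).comp measurable_fst))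
      (Filter.Eventually.of_forall fun x => (measurePreserving_add_right volume _).map_eq)
  have hs : MeasurePreserving (Prod.swap : UnitAddCircle × UnitAddCircle → _) :=
    Measure.measurePreserving_swap
  exact (h β).comp (hs.comp ((h α).comp hs))

lemma abs_walk_snd_le (α β : ℝ) (p : UnitAddCircle × UnitAddCircle) (k : ℕ) :
    |(walk α β p k).2| ≤ k := by
  induction k with
  | zero => simp [walk]
  | succ k ih =>
    rw [walk_succ, walkStep]
    refine (abs_add_le _ _).trans ?_
    rcases circSign_eq_or (p.1 + (((walk α β p k).1 + circSign (p.2 +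
      ((walk α β p k).2 * β : ℝ)) : ℤ) * α : ℝ)) with h | h <;> rw [h] <;> push_cast <;> simp [ih]

lemma abs_walk_snd_le_of_mem {α β : ℝ} {n : ℕ} {p : UnitAddCircle × UnitAddCircle}
    (hp : p ∈ closedWithin α β n) (N : ℕ) : |(walk α β p N).2| ≤ n := by
  obtain ⟨k, hk, hkn, h0⟩ := hp
  have : walk α β p N = walk α β p (N % k) :=
    (Function.IsPeriodicPt.iterate_mod_apply (f := walkStep α β p) (x := 0) h0 N).symm
  rw [this]
  refine (abs_walk_snd_le _ _ _ _).trans ?_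
  have := Nat.mod_lt N hk
  omega

lemma VertBound.abs_walk_snd_le {α β C v : ℝ} (h : VertBound α β C v)
    (p : UnitAddCircle × UnitAddCircle) (N : ℕ) : |((walk α β p N).2 : ℝ)| ≤ C + v * N := by
  obtain ⟨x, y⟩ := p
  induction x using QuotientAddGroup.induction_on with
  | H x =>
    induction y using QuotientAddGroup.induction_on with
    | H y =>
      have := h x y _ _ N (isPath_walk α β x y N)
      simpa [walk] using this

lemma walk_snd_eq_sum (α β : ℝ) (p : UnitAddCircle × UnitAddCircle) (N : ℕ) :
    (walk α β p N).2 = ∑ k ∈ Finset.range N, circSign ((walkMap α β)^[k + 1] p).1 := by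
  induction N with
  | zero => simp [walk]
  | succ N ih =>
    rw [Finset.sum_range_succ, ← ih, walkMap_iterate, walk_succ]
    rfl

lemma integrable_intCast {Ω : Type*} [MeasurableSpace Ω] {μ : Measure Ω} [IsFiniteMeasure μ]
    {f : Ω → ℤ} (hf : Measurable f) (K : ℝ) (hK : ∀ x, |(f x : ℝ)| ≤ K) :
    Integrable (fun x => (f x : ℝ)) μ :=
  Integrable.of_bound (measurable_from_top.comp hf).aestronglyMeasurable K
    (Filter.Eventually.of_forall hK)

instance : IsProbabilityMeasure (volume : Measure UnitAddCircle) := ⟨UnitAddCircle.measure_univ⟩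

instance : IsProbabilityMeasure (volume : Measure (UnitAddCircle × UnitAddCircle)) :=
  inferInstanceAs (IsProbabilityMeasure (volume.prod volume))

instance : (volume : Measure (UnitAddCircle × UnitAddCircle)).IsAddRightInvariant :=
  inferInstanceAs ((volume.prod volume).IsAddRightInvariant)

lemma abs_circSign (x : UnitAddCircle) : |(circSign x : ℝ)| = 1 := by
  rcases circSign_eq_or x with h | h <;> rw [h] <;> simp

/-- A function invariant under the first rotation sees the walk advance at a constant mean rate. -/
lemma integral_mul_walk_snd {α β : ℝ} {g : UnitAddCircle → ℤ} (hg : Measurable g)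
    (hg1 : ∀ x, |(g x : ℝ)| ≤ 1) (hinv : ∀ x (i : ℤ), g (x + (i * α : ℝ)) = g x) (N : ℕ) :
    ∫ p : UnitAddCircle × UnitAddCircle, ((g p.1 * (walk α β p N).2 : ℤ) : ℝ) =
      N * ∫ p : UnitAddCircle × UnitAddCircle, ((g p.1 * circSign p.1 : ℤ) : ℝ) := by
  set f : UnitAddCircle × UnitAddCircle → ℝ := fun z => ((g z.1 * circSign z.1 : ℤ) : ℝ) with hf
  have hterm : ∀ p : UnitAddCircle × UnitAddCircle, ((g p.1 * (walk α β p N).2 : ℤ) : ℝ) =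
      ∑ k ∈ Finset.range N, f ((walkMap α β)^[k + 1] p) := by
    intro p
    rw [walk_snd_eq_sum, Finset.mul_sum, Int.cast_sum]
    refine Finset.sum_congr rfl fun k _ => ?_
    have : g ((walkMap α β)^[k + 1] p).1 = g p.1 := by rw [walkMap_iterate]; exact hinv _ _
    simp only [hf, this]
  have hm : Measurable fun z : UnitAddCircle × UnitAddCircle => g z.1 * circSign z.1 :=
    (hg.comp measurable_fst).mul (measurable_circSign.comp measurable_fst)
  have hint : Integrable f :=
    integrable_intCast hm 1 fun z => by
      rw [Int.cast_mul, abs_mul, abs_circSign, mul_one]; exact hg1 _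
  have hmp := fun k => (measurePreserving_walkMap α β).iterate (k + 1)
  simp_rw [hterm]
  have hik : ∀ k, Integrable fun p => f ((walkMap α β)^[k + 1] p) := fun k =>
    (hmp k).integrable_comp_of_integrable hint
  have hkc : ∀ k, ∫ p, f ((walkMap α β)^[k + 1] p) = ∫ p, f p := fun k => by
    have := integral_map (hmp k).aemeasurable (f := f)
      (by rw [(hmp k).map_eq]; exact hint.aestronglyMeasurable)
    rw [(hmp k).map_eq] at this
    exact this.symm
  rw [integral_finsetSum _ fun k _ => hik k, Finset.sum_congr rfl fun k _ => hkc k]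
  simp

lemma IsSlow.one_le {κ α β : ℝ} (h : IsSlow κ α β) (n : ℕ) :
    1 ≤ κ * (1 - volume.real (closedWithin α β n)) := by
  obtain ⟨p, q, -, C, v, hq, hα, -, hC, hv, hV, hκ⟩ := h
  have hq' : (0 : ℝ) < q := by exact_mod_cast hq.pos
  set a : UnitAddCircle := (α : UnitAddCircle) with ha
  have hqa : q • a = 0 := by
    rw [ha, ← AddCircle.coe_nsmul, hα, nsmul_eq_mul, mul_div_cancel₀ _ hq'.ne',
      AddCircle.coe_eq_zero_iff]
    exact ⟨p, by simp⟩
  set S : UnitAddCircle → ℤ := fun x => ∑ i ∈ Finset.range q, circSign (x + i • a) with hS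
  have hSodd : ∀ x, Odd (S x) := fun x =>
    odd_sum_sign _ _ (fun i => circSign_eq_or _) (by simpa using hq)
  have hSa : ∀ x, S (x + a) = S x := by
    intro x
    have h1 := Finset.sum_range_succ (fun i : ℕ => circSign (x + i • a)) q
    have h2 := Finset.sum_range_succ' (fun i : ℕ => circSign (x + i • a)) q
    rw [hqa, add_zero] at h1
    rw [zero_smul, add_zero] at h2
    have h3 : S (x + a) = ∑ i ∈ Finset.range q, circSign (x + (i + 1) • a) :=
      Finset.sum_congr rfl fun i _ => by rw [add_smul, one_smul]; congr 1; abel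
    rw [h3]
    linarith
  have hSz : ∀ x (i : ℤ), S (x + i • a) = S x := by
    intro x i
    induction i using Int.induction_on with
    | zero => simp
    | succ i ih => rw [add_smul, one_smul, ← add_assoc, hSa, ih]
    | pred i ih => rw [← hSa, sub_smul, one_smul, ← ih]; congr 1; abel
  have hSm : Measurable S := Finset.measurable_sum _ fun i _ =>
    measurable_circSign.comp (measurable_id.add_const _)
  set g : UnitAddCircle → ℤ := fun x => (S x).sign with hg
  have hgm : Measurable g := (Measurable.of_discrete (f := Int.sign)).comp hSm
  have hg1 : ∀ x, |(g x : ℝ)| ≤ 1 := by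
    intro x
    rcases Int.sign_trichotomy (S x) with h | h | h <;> simp [hg, h]
  have hgz : ∀ x (i : ℤ), g (x + i • a) = g x := fun x i => by simp only [hg, hSz]
  have hinv : ∀ x (i : ℤ), g (x + (i * α : ℝ)) = g x := fun x i => by
    rw [← zsmul_eq_mul, AddCircle.coe_zsmul, hgz]
  set c := ∫ p : UnitAddCircle × UnitAddCircle, ((g p.1 * circSign p.1 : ℤ) : ℝ) with hc
  have hm : Measurable fun z : UnitAddCircle × UnitAddCircle => g z.1 * circSign z.1 :=
    (hgm.comp measurable_fst).mul (measurable_circSign.comp measurable_fst)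
  have hint : Integrable fun z : UnitAddCircle × UnitAddCircle =>
      ((g z.1 * circSign z.1 : ℤ) : ℝ) :=
    integrable_intCast hm 1 fun z => by
      rw [Int.cast_mul, abs_mul, abs_circSign, mul_one]; exact hg1 _
  have hqc : 1 ≤ q * c := by
    have e1 : ∀ i : ℕ, ∫ p : UnitAddCircle × UnitAddCircle,
        ((g p.1 * circSign (p.1 + i • a) : ℤ) : ℝ) = c := by
      intro i
      rw [hc, ← integral_add_right_eq_self
        (fun p : UnitAddCircle × UnitAddCircle => ((g p.1 * circSign p.1 : ℤ) : ℝ)) (i • a, 0)]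
      refine integral_congr_ae (Filter.Eventually.of_forall fun p => ?_)
      have := hgz p.1 i
      rw [natCast_zsmul] at this
      simp only [Prod.fst_add, this]
    have e2 : (q : ℝ) * c = ∫ p : UnitAddCircle × UnitAddCircle, ((g p.1 * S p.1 : ℤ) : ℝ) := by
      have : ∀ p : UnitAddCircle × UnitAddCircle, ((g p.1 * S p.1 : ℤ) : ℝ) =
          ∑ i ∈ Finset.range q, ((g p.1 * circSign (p.1 + i • a) : ℤ) : ℝ) := by
        intro p
        rw [← Int.cast_sum, ← Finset.mul_sum]
      simp_rw [this]
      rw [integral_finsetSum _ fun i _ => ?_, Finset.sum_congr rfl fun i _ => e1 i]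
      · simp
      · refine integrable_intCast ((hgm.comp measurable_fst).mul
          (measurable_circSign.comp (measurable_fst.add_const _))) 1 fun z => ?_
        rw [Int.cast_mul, abs_mul, abs_circSign, mul_one]; exact hg1 _
    have e3 : ∀ x, 1 ≤ g x * S x := by
      intro x
      simp only [hg]
      rw [Int.sign_mul_self_eq_abs]
      obtain ⟨k, hk⟩ := hSodd x
      exact Int.one_le_abs (by omega)
    have e4 : ∀ x, |S x| ≤ q := fun x => by
      simpa using abs_sum_sign_le (Finset.range q) (fun i => circSign (x + i • a))
        fun i => circSign_eq_or _
    rw [e2]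
    have hgS : Measurable fun z : UnitAddCircle × UnitAddCircle => g z.1 * S z.1 :=
      (hgm.comp measurable_fst).mul (hSm.comp measurable_fst)
    calc (1 : ℝ) = ∫ _ : UnitAddCircle × UnitAddCircle, (1 : ℝ) := by simp
      _ ≤ _ := integral_mono (integrable_const _)
        (integrable_intCast hgS q
          fun z => by
            rw [Int.cast_mul, abs_mul]
            have h1 := hg1 z.1
            have h2 : |(S z.1 : ℝ)| ≤ q := by exact_mod_cast e4 z.1
            nlinarith [abs_nonneg (S z.1 : ℝ), abs_nonneg (g z.1 : ℝ)])
        fun z => by simpa using Int.cast_le (R := ℝ).2 (e3 z.1)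
  set μ := volume.real (closedWithin α β n) with hμ
  have hμ1 : μ ≤ 1 := measureReal_le_one
  have hmeas := measurableSet_closedWithin α β n
  have hflux : ∀ N : ℕ, N * c ≤ n * μ + (C + v * N) * (1 - μ) := by
    intro N
    have hR : ∀ s : Set (UnitAddCircle × UnitAddCircle), MeasurableSet s → ∀ K : ℝ,
        Integrable (s.indicator fun _ => K) := fun s hs K => (integrable_const K).indicator hs
    rw [hc, ← integral_mul_walk_snd (β := β) hgm hg1 hinv N]
    calc _ ≤ ∫ z : UnitAddCircle × UnitAddCircle,
          ((closedWithin α β n).indicator (fun _ => (n : ℝ)) z +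
            (closedWithin α β n)ᶜ.indicator (fun _ => C + v * N) z) := by
          refine integral_mono ?_ ((hR _ hmeas _).add (hR _ hmeas.compl _)) fun z => ?_
          · refine integrable_intCast ((hgm.comp measurable_fst).mul
              (measurable_walk α β N).snd) N fun z => ?_
            rw [Int.cast_mul, abs_mul]
            have h1 := hg1 z.1
            have h2 : |((walk α β z N).2 : ℝ)| ≤ N := by exact_mod_cast abs_walk_snd_le α β z N
            nlinarith [abs_nonneg ((walk α β z N).2 : ℝ), abs_nonneg (g z.1 : ℝ)]
          · have h0 : ((g z.1 * (walk α β z N).2 : ℤ) : ℝ) ≤ |((walk α β z N).2 : ℝ)| := by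
              refine (le_abs_self _).trans ?_
              rw [Int.cast_mul, abs_mul]
              have h1 := hg1 z.1
              nlinarith [abs_nonneg ((walk α β z N).2 : ℝ)]
            refine h0.trans ?_
            by_cases hz : z ∈ closedWithin α β n
            · simp only [Set.indicator_of_mem hz, Set.indicator_of_notMem (Set.notMem_compl_iff.2 hz),
                add_zero]
              exact_mod_cast abs_walk_snd_le_of_mem hz N
            · simp only [Set.indicator_of_notMem hz, Set.indicator_of_mem (Set.mem_compl hz),
                zero_add]
              exact hV.abs_walk_snd_le z N
      _ = _ := by
          rw [integral_add (hR _ hmeas _) (hR _ hmeas.compl _), integral_indicator_const _ hmeas,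
            integral_indicator_const _ hmeas.compl, probReal_compl_eq_one_sub hmeas]
          simp only [smul_eq_mul, hμ]; ring
  have hcv : c ≤ v * (1 - μ) := by
    by_contra! hlt
    obtain ⟨N, hN⟩ := exists_nat_gt ((n * μ + C * (1 - μ)) / (c - v * (1 - μ)))
    rw [div_lt_iff₀ (sub_pos.2 hlt)] at hN
    have := hflux N
    linarith
  calc (1 : ℝ) ≤ q * c := hqc
    _ ≤ q * (v * (1 - μ)) := by gcongr
    _ = q * v * (1 - μ) := by ring
    _ ≤ κ * (1 - μ) := mul_le_mul_of_nonneg_right hκ.le (sub_nonneg.2 hμ1)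

lemma eventually_circSign_eq {u : UnitAddCircle} (hu : u + u ≠ 0) :
    ∀ᶠ u' in nhds u, circSign u' = circSign u := by
  induction u using QuotientAddGroup.induction_on with
  | H x =>
    have hx : ∀ k : ℤ, (2 * x : ℝ) ≠ k := fun k hk => hu (by
      rw [← QuotientAddGroup.mk_add]
      exact AddCircle.coe_eq_zero_iff _ |>.2 ⟨k, by rw [← two_mul, hk]; simp⟩)
    rw [QuotientAddGroup.nhds_eq, Filter.eventually_map]
    have h1 : (⌊2 * x⌋ : ℝ) < 2 * x := lt_of_le_of_ne (Int.floor_le _) (hx _).symm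
    have h2 := Int.lt_floor_add_one (2 * x)
    have h3 : ∀ᶠ t in nhds x, 2 * t ∈ Set.Ioo (⌊2 * x⌋ : ℝ) (⌊2 * x⌋ + 1) :=
      (continuous_const.mul continuous_id).continuousAt.eventually
        (isOpen_Ioo.mem_nhds ⟨h1, h2⟩)
    filter_upwards [h3] with t ht
    exact halfSign_congr (Int.floor_eq_iff.2 ⟨ht.1.le, ht.2⟩)

lemma ae_add_self_ne_zero : ∀ᵐ u : UnitAddCircle, u + u ≠ 0 := by
  have hmeas : MeasurableSet {u : UnitAddCircle | u + u = 0} :=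
    (isClosed_eq (continuous_id.add continuous_id) continuous_const).measurableSet
  have hsub : ((↑) : ℝ → UnitAddCircle) ⁻¹' {u | u + u = 0} ⊆
      Set.range fun k : ℤ => (k / 2 : ℝ) := by
    intro x hx
    obtain ⟨k, hk⟩ := (AddCircle.coe_eq_zero_iff (1 : ℝ) (x := x + x)).1 hx
    refine ⟨k, ?_⟩
    have : (k : ℝ) = x + x := by simpa using hk
    simp only
    linarith
  have hnull : volume {u : UnitAddCircle | u + u = 0} = 0 := by
    rw [← (UnitAddCircle.measurePreserving_mk 0).measure_preimage hmeas.nullMeasurableSet]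
    exact ((Set.countable_range _).mono hsub).measure_zero _
  simpa [ae_iff] using hnull

lemma ae_generic (α β : ℝ) : ∀ᵐ p : UnitAddCircle × UnitAddCircle, ∀ i : ℤ,
    p.1 + (i * α : ℝ) + (p.1 + (i * α : ℝ)) ≠ 0 ∧ p.2 + (i * β : ℝ) + (p.2 + (i * β : ℝ)) ≠ 0 := by
  rw [ae_all_iff]
  intro i
  have h : ∀ c : UnitAddCircle, ∀ᵐ u : UnitAddCircle, u + c + (u + c) ≠ 0 := fun c =>
    
    (measurePreserving_add_right volume c).quasiMeasurePreserving.ae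
      (p := fun u : UnitAddCircle => u + u ≠ 0) ae_add_self_ne_zero
  have h1 := Measure.quasiMeasurePreserving_fst (μ := (volume : Measure UnitAddCircle))
    (ν := (volume : Measure UnitAddCircle)) |>.ae (h (i * α : ℝ))
  have h2 := Measure.quasiMeasurePreserving_snd (μ := (volume : Measure UnitAddCircle))
    (ν := (volume : Measure UnitAddCircle)) |>.ae (h (i * β : ℝ))
  filter_upwards [h1, h2] with p e1 e2 using ⟨e1, e2⟩

/-- For almost every base point the walk is locally constant in the slopes. -/
lemma eventually_walk_eq {α β : ℝ} {p : UnitAddCircle × UnitAddCircle}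
    (hp : ∀ i : ℤ, p.1 + (i * α : ℝ) + (p.1 + (i * α : ℝ)) ≠ 0 ∧
      p.2 + (i * β : ℝ) + (p.2 + (i * β : ℝ)) ≠ 0) (k : ℕ) :
    ∀ᶠ w : ℝ × ℝ in nhds (α, β), walk w.1 w.2 p k = walk α β p k := by
  induction k with
  | zero => exact Filter.Eventually.of_forall fun _ => rfl
  | succ k ih =>
    have hc : ∀ (i : ℤ) (u : UnitAddCircle) (f : ℝ × ℝ → ℝ), Continuous f →
        u + (i * f (α, β) : ℝ) + (u + (i * f (α, β) : ℝ)) ≠ 0 →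
        ∀ᶠ w in nhds (α, β), circSign (u + (i * f w : ℝ)) = circSign (u + (i * f (α, β) : ℝ)) :=
      fun i u f hf hne => by
        have : Continuous fun w => u + ((i * f w : ℝ) : UnitAddCircle) :=
          continuous_const.add ((AddCircle.continuous_mk' 1).comp (continuous_const.mul hf))
        exact this.continuousAt.eventually (eventually_circSign_eq hne)
    filter_upwards [ih, hc (walk α β p k).2 p.2 Prod.snd continuous_snd (hp _).2,
      hc (walk α β p (k + 1)).1 p.1 Prod.fst continuous_fst (hp _).1] with w h1 h2 h3
    rw [walk_succ, walk_succ, h1]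
    rw [walk_succ] at h3
    simp only [walkStep] at h3 ⊢
    rw [h2, h3]

lemma continuous_measure_closedWithin (n : ℕ) :
    Continuous fun w : ℝ × ℝ => volume.real (closedWithin w.1 w.2 n) := by
  rw [continuous_iff_continuousAt]
  rintro ⟨α, β⟩
  have h : ∀ w : ℝ × ℝ, volume.real (closedWithin w.1 w.2 n) =
      ∫ p, (closedWithin w.1 w.2 n).indicator (fun _ => (1 : ℝ)) p := fun w => by
    rw [integral_indicator_const _ (measurableSet_closedWithin _ _ n), smul_eq_mul, mul_one]
  simp_rw [h]
  refine continuousAt_of_dominated (bound := fun _ => 1)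
    (Filter.Eventually.of_forall fun w =>
      (measurable_const.indicator (measurableSet_closedWithin _ _ n)).aestronglyMeasurable)
    (Filter.Eventually.of_forall fun w => Filter.Eventually.of_forall fun p => ?_)
    (integrable_const _) ?_
  · rw [Set.indicator_apply]; split_ifs <;> simp
  · filter_upwards [ae_generic α β] with p hp
    refine ContinuousAt.congr (f := fun _ => (closedWithin α β n).indicator (fun _ => (1 : ℝ)) p)
      continuousAt_const ?_
    have := (Filter.eventually_all_finite (Set.finite_Iic n)).2 fun k _ => eventually_walk_eq hp k
    filter_upwards [this] with w hw
    have hmem : p ∈ closedWithin α β n ↔ p ∈ closedWithin w.1 w.2 n :=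
      exists_congr fun k => and_congr_right fun _ => and_congr_right fun hk => by rw [hw k hk]
    simp only [Set.indicator_apply, hmem]

/-- Slopes in the closure of the slow pairs have a definite proportion of non-closed walks. -/
lemma volume_iUnion_closedWithin_lt_one {κ : ℝ} {w : ℝ × ℝ}
    (hw : w ∈ closure {w : ℝ × ℝ | IsSlow κ w.1 w.2}) :
    volume (⋃ n, closedWithin w.1 w.2 n) < 1 := by
  have h1 : ∀ n, 1 ≤ κ * (1 - volume.real (closedWithin w.1 w.2 n)) := fun n => by
    have hcl : IsClosed {w : ℝ × ℝ | 1 ≤ κ * (1 - volume.real (closedWithin w.1 w.2 n))} :=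
      isClosed_le continuous_const
        (continuous_const.mul (continuous_const.sub (continuous_measure_closedWithin n)))
    exact closure_minimal (fun w hw => IsSlow.one_le hw n) hcl hw
  have hκ : 0 < κ := by
    by_contra! hκ
    have := h1 0
    have h2 : volume.real (closedWithin w.1 w.2 0) ≤ 1 := measureReal_le_one
    nlinarith
  have hmono : Monotone fun n => closedWithin w.1 w.2 n := fun a b hab p ⟨k, h1, h2, h3⟩ =>
    ⟨k, h1, h2.trans hab, h3⟩
  rw [hmono.measure_iUnion]
  refine lt_of_le_of_lt (b := ENNReal.ofReal (1 - 1 / κ)) (iSup_le fun n => ?_) ?_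
  · rw [← ofReal_measureReal]
    apply ENNReal.ofReal_le_ofReal
    have := h1 n
    rw [← div_le_iff₀' hκ] at this
    linarith
  · rw [← ENNReal.ofReal_one]
    exact ENNReal.ofReal_lt_ofReal_iff_of_nonneg (by
      have := h1 0
      rw [← div_le_iff₀' hκ] at this
      have h2 : 0 ≤ volume.real (closedWithin w.1 w.2 0) := measureReal_nonneg
      linarith) |>.2 (by have : 0 < 1 / κ := by positivity
                         linarith)

lemma mem_Lam_iff {l : ℝ × ℝ} : l ∈ Lam ↔ ∃ i j : ℤ, l = ((i / 2 : ℝ), (i / 2 + j : ℝ)) := by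
  constructor
  · intro hl
    induction hl using AddSubgroup.closure_induction with
    | mem x hx =>
      rcases hx with rfl | rfl
      · exact ⟨1, 0, by simp⟩
      · exact ⟨-1, 1, by ext <;> norm_num⟩
    | zero => exact ⟨0, 0, by ext <;> simp⟩
    | add x y _ _ hx hy =>
      obtain ⟨i, j, rfl⟩ := hx
      obtain ⟨i', j', rfl⟩ := hy
      exact ⟨i + i', j + j', by ext <;> simp <;> ring⟩
    | neg x _ hx =>
      obtain ⟨i, j, rfl⟩ := hx
      exact ⟨-i, -j, by ext <;> simp <;> ring⟩
  · rintro ⟨i, j, rfl⟩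
    have h1 : ((1 : ℝ) / 2, (1 : ℝ) / 2) ∈ Lam := AddSubgroup.subset_closure (by simp)
    have h2 : (-((1 : ℝ) / 2), (1 : ℝ) / 2) ∈ Lam := AddSubgroup.subset_closure (by simp)
    have := add_mem (zsmul_mem h1 (i + j)) (zsmul_mem h2 j)
    convert this using 1
    ext <;> simp <;> ring

lemma halfSign_mul_add_mem {l : ℝ × ℝ} (hl : l ∈ Lam) (p : ℝ × ℝ) :
    halfSign (p.1 + l.1) * halfSign (p.2 + l.2) = halfSign p.1 * halfSign p.2 := by
  obtain ⟨i, j, rfl⟩ := mem_Lam_iff.1 hl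
  rcases Int.even_or_odd' i with ⟨k, rfl | rfl⟩
  · rw [show p.1 + (((2 * k : ℤ) : ℝ) / 2) = p.1 + k by push_cast; ring,
      show p.2 + (((2 * k : ℤ) : ℝ) / 2 + j) = p.2 + (k + j : ℤ) by push_cast; ring,
      halfSign_add_int, halfSign_add_int]
  · rw [show p.1 + (((2 * k + 1 : ℤ) : ℝ) / 2) = p.1 + 1 / 2 + k by push_cast; ring,
      show p.2 + (((2 * k + 1 : ℤ) : ℝ) / 2 + j) = p.2 + 1 / 2 + (k + j : ℤ) by push_cast; ring,
      halfSign_add_int, halfSign_add_int, halfSign_add_half, halfSign_add_half, neg_mul_neg]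

lemma sgn_mk_s3 (p : ℝ × ℝ) : sgn (QuotientAddGroup.mk p : Y) = halfSign p.1 * halfSign p.2 := by
  have hout : ∀ q : Y, sgn q = halfSign q.out.1 * halfSign q.out.2 := by
    intro q
    have h2 : halfSign q.out.2 = -halfSign (q.out.2 - 1 / 2) := by
      rw [← halfSign_add_half, sub_add_cancel]
    rw [halfSign_eq_ite_even q.out.1]
    unfold sgn fundRep
    by_cases h : Even ⌊2 * q.out.1⌋
    · rw [if_pos h, if_pos h, one_mul]; rfl
    · rw [if_neg h, if_neg h, h2, neg_mul_neg, one_mul]; rfl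
  rw [hout]
  have h : -p + (QuotientAddGroup.mk p : Y).out ∈ Lam :=
    QuotientAddGroup.eq.1 (Quotient.out_eq _).symm
  rw [← halfSign_mul_add_mem h p]
  simp

lemma halfSign_mul_self (x : ℝ) : halfSign x * halfSign x = 1 := by
  rcases halfSign_eq_or x with h | h <;> rw [h] <;> rfl

/-- Two steps of `Psi` from a vertical state perform one step of the walk. -/
lemma Psi_Psi (α β x y : ℝ) :
    Psi α β (Psi α β (QuotientAddGroup.mk (x, y), (0, halfSign x))) =
      (QuotientAddGroup.mk (x + halfSign y * α, y + halfSign (x + halfSign y * α) * β),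
        (0, halfSign (x + halfSign y * α))) := by
  have h1 : Psi α β (QuotientAddGroup.mk (x, y), (0, halfSign x)) =
      (QuotientAddGroup.mk (x + halfSign y * α, y), (halfSign y, 0)) := by
    simp only [Psi, sgn_mk_s3, ← QuotientAddGroup.mk_add, ← mul_assoc, halfSign_mul_self, one_mul,
      zero_mul, Prod.mk_add_mk, Int.cast_zero, add_zero]
  rw [h1]
  have h2 : ∀ z : ℝ, halfSign y * (halfSign z * halfSign y) = halfSign z := fun z => by
    rw [mul_left_comm, halfSign_mul_self, mul_one]
  simp only [Psi, sgn_mk_s3, ← QuotientAddGroup.mk_add, h2, zero_mul, Prod.mk_add_mk, Int.cast_zero,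
    add_zero]

lemma Psi_iterate (α β x y : ℝ) (k : ℕ) :
    (Psi α β)^[2 * k] (QuotientAddGroup.mk (x, y), (0, halfSign x)) =
      (QuotientAddGroup.mk (x + (walk α β (x, y) k).1 * α, y + (walk α β (x, y) k).2 * β),
        (0, halfSign (x + (walk α β (x, y) k).1 * α))) := by
  induction k with
  | zero => simp [walk]
  | succ k ih =>
    rw [mul_add, mul_one, Function.iterate_succ_apply', Function.iterate_succ_apply', ih, Psi_Psi,
      walk_succ]
    simp only [walkStep, ← AddCircle.coe_add, circSign_coe, Int.cast_add, add_mul, add_assoc]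

lemma mem_closedWithin_of_periodic {α β x y : ℝ} (hα : Irrational α) (hβ : Irrational β) {n : ℕ}
    (hn : 1 ≤ n) (h : (Psi α β)^[n] (QuotientAddGroup.mk (x, y), (0, halfSign x)) =
      (QuotientAddGroup.mk (x, y), (0, halfSign x))) :
    ((x : UnitAddCircle), (y : UnitAddCircle)) ∈ closedWithin α β n := by
  have h2 : (Psi α β)^[2 * n] (QuotientAddGroup.mk (x, y), (0, halfSign x)) =
      (QuotientAddGroup.mk (x, y), (0, halfSign x)) := by
    rw [two_mul, Function.iterate_add_apply, h, h]
  rw [Psi_iterate] at h2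
  have h3 := QuotientAddGroup.eq.1 (congrArg Prod.fst h2).symm
  rw [mem_Lam_iff] at h3
  obtain ⟨i, j, hij⟩ := h3
  simp only [Prod.neg_mk, Prod.mk_add_mk, neg_add_cancel_left, Prod.mk.injEq] at hij
  have hz : ∀ (γ : ℝ) (k : ℤ) (r : ℚ), Irrational γ → k * γ = r → k = 0 := by
    intro γ k r hγ hk
    by_contra h0
    exact (hγ.intCast_mul h0) ⟨r, hk.symm⟩
  refine ⟨n, hn, le_rfl, Prod.ext (hz α _ (i / 2) hα ?_) (hz β _ (i / 2 + j) hβ ?_)⟩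
  · rw [hij.1]; push_cast; rfl
  · rw [hij.2]; push_cast; rfl

instance : IsProbabilityMeasure mY := by
  refine ⟨?_⟩
  have hmk : Measurable (QuotientAddGroup.mk : ℝ × ℝ → Y) := QuotientAddGroup.measurable_coe
  rw [mY, Measure.map_apply hmk MeasurableSet.univ, Set.preimage_univ, Measure.smul_apply,
    Measure.restrict_apply_univ, Measure.volume_eq_prod, Measure.prod_prod, Real.volume_Ico,
    Real.volume_Ico, smul_eq_mul, sub_zero, sub_zero, ENNReal.ofReal_one, mul_one, one_div,
    ENNReal.ofReal_inv_of_pos two_pos, ENNReal.ofReal_ofNat]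
  exact ENNReal.mul_inv_cancel two_ne_zero ENNReal.ofNat_ne_top

instance : IsProbabilityMeasure mN := by
  refine ⟨?_⟩
  simp only [mN, Measure.smul_apply, Measure.add_apply, Measure.dirac_apply_of_mem (Set.mem_univ _),
    smul_eq_mul]
  rw [show (1 + 1 + 1 + 1 : ℝ≥0∞) = 4 by norm_num]
  exact ENNReal.inv_mul_cancel (by norm_num) (by norm_num)

lemma mN_singleton_ne_zero {ε : ℤ} (hε : ε = 1 ∨ ε = -1) : mN {((0 : ℤ), ε)} ≠ 0 := by
  rcases hε with rfl | rfl <;> simp [mN]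

instance : IsProbabilityMeasure lamMeas := inferInstanceAs (IsProbabilityMeasure (mY.prod mN))

lemma Mab_ne_one {α β : ℝ} (hα : Irrational α) (hβ : Irrational β)
    (h : volume (⋃ n, closedWithin α β n) < 1) : Mab α β ≠ 1 := by
  intro hM
  set E : Set (UnitAddCircle × UnitAddCircle) := ⋃ n, closedWithin α β n with hE
  have hEm : MeasurableSet E := MeasurableSet.iUnion fun n => measurableSet_closedWithin α β n
  set π : ℝ × ℝ → UnitAddCircle × UnitAddCircle := fun p => (p.1, p.2) with hπ
  have hπm : Measurable π := (AddCircle.measurable_mk'.comp measurable_fst).prodMk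
    (AddCircle.measurable_mk'.comp measurable_snd)
  set mk : ℝ × ℝ → Y := QuotientAddGroup.mk with hmk
  have hmkm : Measurable mk := QuotientAddGroup.measurable_coe
  set F : Set (ℝ × ℝ) := Set.Ico (0 : ℝ) (1 / 2) ×ˢ Set.Ico (0 : ℝ) 1 with hF
  have hnull : ∀ ε : ℤ, ε = 1 ∨ ε = -1 →
      volume ({p | ∃ i j : ℤ, halfSign (p.1 + i / 2) = ε ∧
        π (p + ((i / 2 : ℝ), (i / 2 + j : ℝ))) ∉ E} ∩ F) = 0 := by
    intro ε hε
    set N : Set Y := {q | ∃ p, mk p = q ∧ halfSign p.1 = ε ∧ π p ∉ E} with hN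
    have hpre : mk ⁻¹' N = {p | ∃ i j : ℤ, halfSign (p.1 + i / 2) = ε ∧
        π (p + ((i / 2 : ℝ), (i / 2 + j : ℝ))) ∉ E} := by
      ext p
      constructor
      · rintro ⟨p', hp', h1, h2⟩
        obtain ⟨i, j, hij⟩ := mem_Lam_iff.1 (QuotientAddGroup.eq.1 hp'.symm)
        rw [neg_add_eq_iff_eq_add] at hij
        subst hij
        exact ⟨i, j, h1, h2⟩
      · rintro ⟨i, j, h1, h2⟩
        exact ⟨_, (QuotientAddGroup.mk_add_of_mem _ (mem_Lam_iff.2 ⟨i, j, rfl⟩)), h1, h2⟩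
    have hprem : MeasurableSet (mk ⁻¹' N) := by
      rw [hpre]
      simp only [Set.ofPred_exists]
      refine MeasurableSet.iUnion fun i => MeasurableSet.iUnion fun j => ?_
      exact ((measurable_halfSign.comp (measurable_fst.add_const _))
        (measurableSet_singleton ε)).inter ((hπm.comp (measurable_id.add_const _)) hEm.compl)
    have hNm : MeasurableSet N := hprem
    have hdisj : {p : Y × (ℤ × ℤ) | ∃ n : ℕ, 1 ≤ n ∧ (Psi α β)^[n] p = p} ⊆
        (N ×ˢ {((0 : ℤ), ε)})ᶜ := by
      rintro ⟨q, v⟩ ⟨n, hn, hper⟩ ⟨⟨⟨x, y⟩, h1, h2, h3⟩, hv⟩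
      simp only at h1 h2
      subst h1
      obtain rfl : v = (0, ε) := hv
      subst h2
      exact h3 (Set.mem_iUnion.2 ⟨n, mem_closedWithin_of_periodic hα hβ hn hper⟩)
    have hmeas : MeasurableSet (N ×ˢ {((0 : ℤ), ε)}) := hNm.prod (measurableSet_singleton _)
    have h1 : lamMeas (N ×ˢ {((0 : ℤ), ε)})ᶜ = 1 :=
      le_antisymm prob_le_one (hM ▸ measure_mono hdisj)
    rw [prob_compl_eq_one_iff hmeas] at h1
    rw [lamMeas, Measure.prod_prod, mul_eq_zero, or_iff_left (mN_singleton_ne_zero hε), mY,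
      Measure.map_apply hmkm hNm, Measure.smul_apply, smul_eq_mul, mul_eq_zero,
      or_iff_right two_ne_zero, Measure.restrict_apply hprem, hpre] at h1
    exact h1
  have hD : volume (π ⁻¹' Eᶜ) = 0 := by
    have hsub : π ⁻¹' Eᶜ ⊆ ⋃ (i : ℤ) (j : ℤ),
        (fun p => p + (-(i / 2 : ℝ), -(i / 2 + j : ℝ))) ⁻¹'
          ({p | π (p + ((i / 2 : ℝ), (i / 2 + j : ℝ))) ∉ E} ∩ F) := by
      rintro ⟨x, y⟩ hp
      simp only [Set.mem_iUnion]
      refine ⟨⌊2 * x⌋, ⌊y - ⌊2 * x⌋ / 2⌋, ?_, ?_⟩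
      · simpa only [Set.mem_preimage, Set.mem_ofPred_eq, Prod.mk_add_mk, neg_add_cancel_right,
          Set.mem_compl_iff] using hp
      · have h1 := Int.floor_le (2 * x)
        have h2 := Int.lt_floor_add_one (2 * x)
        have h3 := Int.floor_le (y - ⌊2 * x⌋ / 2)
        have h4 := Int.lt_floor_add_one (y - ⌊2 * x⌋ / 2)
        simp only [hF, Set.mem_prod, Set.mem_Ico, Prod.mk_add_mk]
        refine ⟨⟨?_, ?_⟩, ?_, ?_⟩ <;> linarith
    refine measure_mono_null hsub (measure_iUnion_null fun i => measure_iUnion_null fun j => ?_)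
    rw [measure_preimage_add_right]
    refine measure_mono_null ?_ (measure_union_null (hnull 1 (.inl rfl)) (hnull (-1) (.inr rfl)))
    rintro p ⟨h1, h2⟩
    rcases halfSign_eq_or (p.1 + i / 2) with h | h
    · exact .inl ⟨⟨i, j, h, h1⟩, h2⟩
    · exact .inr ⟨⟨i, j, h, h1⟩, h2⟩
  have hmp : MeasurePreserving π ((volume.restrict (Set.Ioc (0 : ℝ) (0 + 1))).prod
      (volume.restrict (Set.Ioc (0 : ℝ) (0 + 1)))) volume :=
    (UnitAddCircle.measurePreserving_mk 0).prod (UnitAddCircle.measurePreserving_mk 0)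
  have hEc : volume Eᶜ = 0 := by
    rw [← hmp.measure_preimage hEm.compl.nullMeasurableSet, Measure.prod_restrict]
    exact le_antisymm ((Measure.restrict_apply_le _ _).trans hD.le) bot_le
  rw [prob_compl_eq_zero_iff hEm] at hEc
  exact h.ne hEc

/-- The set of pairs `(α,β) ∈ [0,1/2] × [0,1/2]` with `α`, `β` irrational
and `M(α,β) ≠ 1` is dense in `[0,1/2] × [0,1/2]`. -/
theorem dense_irrational_Mab_ne_one :
    Set.Icc (0:ℝ) (1/2) ×ˢ Set.Icc (0:ℝ) (1/2) ⊆
      closure {q : ℝ × ℝ | q ∈ Set.Icc (0:ℝ) (1/2) ×ˢ Set.Icc (0:ℝ) (1/2) ∧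
        Irrational q.1 ∧ Irrational q.2 ∧ Mab q.1 q.2 ≠ 1} := by
  intro z hz
  rw [mem_closure_iff]
  intro U hU hzU
  have hIoo : z ∈ closure (Set.Ioo (0 : ℝ) (1 / 2) ×ˢ Set.Ioo (0 : ℝ) (1 / 2)) := by
    rwa [closure_prod_eq, closure_Ioo (by norm_num)]
  set V := U ∩ Set.Ioo (0 : ℝ) (1 / 2) ×ˢ Set.Ioo (0 : ℝ) (1 / 2) with hV
  have hVo : IsOpen V := hU.inter (isOpen_Ioo.prod isOpen_Ioo)
  obtain ⟨⟨a, b⟩, hab⟩ : V.Nonempty := mem_closure_iff.1 hIoo U hU hzU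
  obtain ⟨ε, hε, hball⟩ := Metric.isOpen_iff.1 hVo _ hab
  obtain ⟨r, hr, hr1, hr2⟩ := exists_odd_den_btwn (lt_add_of_pos_right a hε)
  obtain ⟨s, hs1, hs2⟩ := exists_rat_btwn (lt_add_of_pos_right b hε)
  have hrs : ((r : ℝ), (s : ℝ)) ∈ V := hball (by
    rw [Metric.mem_ball, Prod.dist_eq, max_lt_iff, Real.dist_eq, Real.dist_eq, abs_lt, abs_lt]
    constructor <;> constructor <;> simp only <;> linarith)
  obtain ⟨w, hw, hwcl, hw1, hw2⟩ :=
    exists_irrational_mem_closure_isSlow hVo (isSlow_of_odd_den r s hr) hrs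
  exact ⟨w, hw.1, ⟨Set.Ioo_subset_Icc_self hw.2.1, Set.Ioo_subset_Icc_self hw.2.2⟩, hw1, hw2,
    Mab_ne_one hw1 hw2 (volume_iUnion_closedWithin_lt_one hwcl)⟩
end

section
/- If α, β ∈ [0,1/2] are irrational, then π ∘ Ψ̃_{α,β} = Φ ∘ π as maps (ℝ/ℤ)²×N → X. -/
open scoped Classical

/-- The circle `ℝ/ℤ`. -/
noncomputable abbrev T1 : Type := AddCircle (1:ℝ)

/-- The canonical representative in `[0,1)` of a point of `ℝ/ℤ`. -/
noncomputable def rep1 (x : T1) : ℝ := (AddCircle.equivIco 1 0 x : ℝ)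

/-- `Ω± = {1,−1}^ℤ`, the space of bi-infinite sequences of signs (signs modeled by `ℤˣ`). -/
abbrev Om : Type := ℤ → ℤˣ

/-- `X = Ω± × Ω± × N`. -/
abbrev XSp : Type := Om × Om × (ℤ × ℤ)

/-- `σ^k`: the `k`-th power of the shift map, `(σ^k ω)_n = ω_{n+k}`. -/
def shiftBy (k : ℤ) (ω : Om) : Om := fun n => ω (n + k)

/-- The map `Φ : X → X`, `Φ(ω, η, (a,b)) = (σ^{sb}(ω), σ^{sa}(η), (sb, sa))` where
`s = ω₀·η₀`. -/
def Phi (p : XSp) : XSp :=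
  (shiftBy (((p.1 0 * p.2.1 0 : ℤˣ) : ℤ) * p.2.2.2) p.1,
   shiftBy (((p.1 0 * p.2.1 0 : ℤˣ) : ℤ) * p.2.2.1) p.2.1,
   (((p.1 0 * p.2.1 0 : ℤˣ) : ℤ) * p.2.2.2, ((p.1 0 * p.2.1 0 : ℤˣ) : ℤ) * p.2.2.1))

/-- The sign `s ∈ {1,−1}` attached to a point of `(ℝ/ℤ)²`: `s = 1` if the representatives
of the two coordinates in `[0,1)` lie both in `[0,1/2)` or both in `[1/2,1)`, `s = −1`
otherwise. -/
noncomputable def sgnTil (x y : T1) : ℤ :=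
  if (rep1 x < 1/2 ↔ rep1 y < 1/2) then 1 else -1

/-- The rectangle exchange map `Ψ̃_{α,β}` on `(ℝ/ℤ)² × N`:
`Ψ̃((x,y),(a,b)) = ((x + b·s·α, y + a·s·β) mod ℤ², (s·b, s·a))`. -/
noncomputable def PsiTil (α β : ℝ) (p : (T1 × T1) × (ℤ × ℤ)) : (T1 × T1) × (ℤ × ℤ) :=
  ((p.1.1 + ((((p.2.2 * sgnTil p.1.1 p.1.2 : ℤ) : ℝ) * α : ℝ) : T1),
    p.1.2 + ((((p.2.1 * sgnTil p.1.1 p.1.2 : ℤ) : ℝ) * β : ℝ) : T1)),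
   (sgnTil p.1.1 p.1.2 * p.2.2, sgnTil p.1.1 p.1.2 * p.2.1))

/-- The coding `ς_α : ℝ/ℤ → Ω±` of the rotation by `α`: `ς_α(x)_n = 1` if `x + nα (mod 1)`
has representative in `[0,1/2)`, and `−1` otherwise. -/
noncomputable def code (α : ℝ) (x : T1) : Om := fun n =>
  if rep1 (x + (((n : ℝ) * α : ℝ) : T1)) < 1/2 then 1 else -1

/-- The embedding `π : (ℝ/ℤ)² × N → X`, `π((x,y),v) = (ς_α(x), ς_β(y), v)`. -/
noncomputable def piMap (α β : ℝ) (p : (T1 × T1) × (ℤ × ℤ)) : XSp :=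
  (code α p.1.1, code β p.1.2, p.2)

/-- Translating the base point by `kα` shifts its coding by `k`. -/
theorem code_add_mul (α : ℝ) (x : T1) (k : ℤ) :
    code α (x + (((k : ℝ) * α : ℝ) : T1)) = shiftBy k (code α x) := by
  funext n
  have h : x + (((k : ℝ) * α : ℝ) : T1) + (((n : ℝ) * α : ℝ) : T1)
      = x + ((((n + k : ℤ) : ℝ) * α : ℝ) : T1) := by
    rw [add_assoc, ← AddCircle.coe_add]
    congr 2
    push_cast
    ring
  simp only [code, shiftBy, h]

/-- The product of the central symbols of the two codings is the sign of the point. -/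
theorem code_zero_mul_code_zero (α β : ℝ) (x y : T1) :
    ((code α x 0 * code β y 0 : ℤˣ) : ℤ) = sgnTil x y := by
  simp only [code, sgnTil, Int.cast_zero, zero_mul, AddCircle.coe_zero, add_zero]
  by_cases hx : rep1 x < 1 / 2 <;> by_cases hy : rep1 y < 1 / 2 <;> simp only [hx, hy] <;> simp

/-- If `α, β ∈ [0,1/2]` are irrational, then
`π ∘ Ψ̃_{α,β} = Φ ∘ π` as maps `(ℝ/ℤ)² × N → X`. -/
theorem piMap_semiconj (α β : ℝ)
    (hα : α ∈ Set.Icc (0:ℝ) (1/2)) (hβ : β ∈ Set.Icc (0:ℝ) (1/2))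
    (hαirr : Irrational α) (hβirr : Irrational β) :
    ∀ p : (T1 × T1) × (ℤ × ℤ), p.2 ∈ Nset →
      piMap α β (PsiTil α β p) = Phi (piMap α β p) := by
  rintro ⟨⟨x, y⟩, a, b⟩ _
  simp only [piMap, PsiTil, Phi, code_zero_mul_code_zero, mul_comm (sgnTil x y), code_add_mul]
end
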